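/- arXiv:2401.14871 — 3 statements merged into one kernel-verified Lean document; each statement's English description precedes it below -/
import Mathlib

section
/- Perturbation of discrete Lyapunov equations: let A ∈ ℝ^{n×n} satisfy ρ(A) < 1 and let Σ(A) denote the unique solution of Σ(A) = Iₙ + AΣ(A)Aᵀ. If A' ∈ ℝ^{n×n} satisfies ‖A' − A‖ ≤ 1/(4‖Σ(A)‖(1 + ‖A‖)), then ρ(A') < 1 and ‖Σ(A') − Σ(A)‖ ≤ 4‖Σ(A)‖²(1 + ‖A‖)·‖A' − A‖. -/
open Matrix

noncomputable section

/-- Euclidean norm of a vector. -/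
def eNorm {ι : Type*} [Fintype ι] (v : ι → ℝ) : ℝ :=
  Real.sqrt (∑ i, v i ^ 2)

/-- Frobenius norm of a matrix. -/
def frobNorm {ι κ : Type*} [Fintype ι] [Fintype κ] (A : Matrix ι κ ℝ) : ℝ :=
  Real.sqrt (∑ i, ∑ j, A i j ^ 2)

/-- Spectral (operator 2-) norm of a matrix. -/
def spNorm {ι κ : Type*} [Fintype ι] [Fintype κ] (A : Matrix ι κ ℝ) : ℝ :=
  sSup {r : ℝ | ∃ v : κ → ℝ, eNorm v = 1 ∧ r = eNorm (A.mulVec v)}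

/-- Smallest singular value of a matrix `A`, i.e. the square root of the smallest
eigenvalue of `A * Aᵀ`, expressed as `inf_{‖u‖ = 1} ‖Aᵀ u‖`. -/
def sigMin {ι κ : Type*} [Fintype ι] [Fintype κ] (A : Matrix ι κ ℝ) : ℝ :=
  sInf {r : ℝ | ∃ u : ι → ℝ, eNorm u = 1 ∧ r = eNorm (A.vecMul u)}

/-- `ρ(A) < 1` : the spectral radius of the real square matrix `A` (i.e. the
largest modulus of a complex eigenvalue) is smaller than one. -/
def specLt1 {ι : Type*} [Fintype ι] [DecidableEq ι] (A : Matrix ι ι ℝ) : Prop :=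
  spectralRadius ℂ (A.map Complex.ofReal) < 1

/-- Right inverse `M† = Mᵀ (M Mᵀ)⁻¹` of a full-row-rank matrix. -/
def pinv {ι κ : Type*} [Fintype ι] [Fintype κ] [DecidableEq ι] (A : Matrix ι κ ℝ) :
    Matrix κ ι ℝ :=
  Aᵀ * (A * Aᵀ)⁻¹

/-- Orthogonal projection `Π_A = I - A† A` onto the nullspace of `A`. -/
def projNull {ι κ : Type*} [Fintype ι] [Fintype κ] [DecidableEq ι] [DecidableEq κ]
    (A : Matrix ι κ ℝ) : Matrix κ κ ℝ :=
  1 - pinv A * A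

/-- `Σ(M) = ∑_{i≥0} Mⁱ (Mᵀ)ⁱ`, the unique solution of the discrete Lyapunov
equation `Σ = I + M Σ Mᵀ` when `ρ(M) < 1`. -/
def lyap {k : ℕ} (M : Matrix (Fin k) (Fin k) ℝ) : Matrix (Fin k) (Fin k) ℝ :=
  ∑' i : ℕ, M ^ i * (Mᵀ) ^ i

variable {n m t : ℕ}

/-- Stacked data matrix `D₀ = [U₀; X₀]`. -/
def Dmat (U0 : Matrix (Fin m) (Fin t) ℝ) (X0 : Matrix (Fin n) (Fin t) ℝ) :
    Matrix (Fin m ⊕ Fin n) (Fin t) ℝ :=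
  Matrix.fromRows U0 X0

/-- `Ū₀ = (1/t) U₀ D₀ᵀ`. -/
def Ubar (U0 : Matrix (Fin m) (Fin t) ℝ) (X0 : Matrix (Fin n) (Fin t) ℝ) :
    Matrix (Fin m) (Fin m ⊕ Fin n) ℝ :=
  (t : ℝ)⁻¹ • (U0 * (Dmat U0 X0)ᵀ)

/-- `X̄₀ = (1/t) X₀ D₀ᵀ`. -/
def Xbar0 (U0 : Matrix (Fin m) (Fin t) ℝ) (X0 : Matrix (Fin n) (Fin t) ℝ) :
    Matrix (Fin n) (Fin m ⊕ Fin n) ℝ :=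
  (t : ℝ)⁻¹ • (X0 * (Dmat U0 X0)ᵀ)

/-- `X̄₁ = (1/t) X₁ D₀ᵀ`. -/
def Xbar1 (U0 : Matrix (Fin m) (Fin t) ℝ) (X0 X1 : Matrix (Fin n) (Fin t) ℝ) :
    Matrix (Fin n) (Fin m ⊕ Fin n) ℝ :=
  (t : ℝ)⁻¹ • (X1 * (Dmat U0 X0)ᵀ)

/-- Sample covariance `Φ = (1/t) D₀ D₀ᵀ`. -/
def Phi (U0 : Matrix (Fin m) (Fin t) ℝ) (X0 : Matrix (Fin n) (Fin t) ℝ) :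
    Matrix (Fin m ⊕ Fin n) (Fin m ⊕ Fin n) ℝ :=
  (t : ℝ)⁻¹ • (Dmat U0 X0 * (Dmat U0 X0)ᵀ)

/-- The feasible set `S = {V : X̄₀ V = I, ρ(X̄₁ V) < 1}`. -/
def feasSet (U0 : Matrix (Fin m) (Fin t) ℝ) (X0 X1 : Matrix (Fin n) (Fin t) ℝ) :
    Set (Matrix (Fin m ⊕ Fin n) (Fin n) ℝ) :=
  {V | Xbar0 U0 X0 * V = 1 ∧ specLt1 (Xbar1 U0 X0 X1 * V)}

/-- The closed-loop Lyapunov solution `Σ_V`, i.e. the unique solution of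
`Σ_V = I + (X̄₁ V) Σ_V (X̄₁ V)ᵀ` when `V ∈ S`. -/
def SigV (U0 : Matrix (Fin m) (Fin t) ℝ) (X0 X1 : Matrix (Fin n) (Fin t) ℝ)
    (V : Matrix (Fin m ⊕ Fin n) (Fin n) ℝ) : Matrix (Fin n) (Fin n) ℝ :=
  lyap (Xbar1 U0 X0 X1 * V)

/-- `P_V`, the unique solution of `P = Q + Vᵀ Ū₀ᵀ R Ū₀ V + (X̄₁V)ᵀ P (X̄₁V)`
when `V ∈ S`, given by its convergent series. -/
def PV (U0 : Matrix (Fin m) (Fin t) ℝ) (X0 X1 : Matrix (Fin n) (Fin t) ℝ)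
    (Q : Matrix (Fin n) (Fin n) ℝ) (R : Matrix (Fin m) (Fin m) ℝ)
    (V : Matrix (Fin m ⊕ Fin n) (Fin n) ℝ) : Matrix (Fin n) (Fin n) ℝ :=
  ∑' i : ℕ, ((Xbar1 U0 X0 X1 * V)ᵀ) ^ i *
      (Q + Vᵀ * (Ubar U0 X0)ᵀ * R * Ubar U0 X0 * V) * (Xbar1 U0 X0 X1 * V) ^ i

/-- The covariance-parameterized LQR cost `J(V)`. -/
def Jcost (U0 : Matrix (Fin m) (Fin t) ℝ) (X0 X1 : Matrix (Fin n) (Fin t) ℝ)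
    (Q : Matrix (Fin n) (Fin n) ℝ) (R : Matrix (Fin m) (Fin m) ℝ)
    (V : Matrix (Fin m ⊕ Fin n) (Fin n) ℝ) : ℝ :=
  Matrix.trace ((Q + Vᵀ * (Ubar U0 X0)ᵀ * R * Ubar U0 X0 * V) * SigV U0 X0 X1 V)

/-- `J* = inf_{V ∈ S} J(V)`. -/
def Jstar (U0 : Matrix (Fin m) (Fin t) ℝ) (X0 X1 : Matrix (Fin n) (Fin t) ℝ)
    (Q : Matrix (Fin n) (Fin n) ℝ) (R : Matrix (Fin m) (Fin m) ℝ) : ℝ :=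
  sInf (Jcost U0 X0 X1 Q R '' feasSet U0 X0 X1)

/-- Sublevel set `S(a) = {V ∈ S : J(V) ≤ a}`. -/
def subLevel (U0 : Matrix (Fin m) (Fin t) ℝ) (X0 X1 : Matrix (Fin n) (Fin t) ℝ)
    (Q : Matrix (Fin n) (Fin n) ℝ) (R : Matrix (Fin m) (Fin m) ℝ) (a : ℝ) :
    Set (Matrix (Fin m ⊕ Fin n) (Fin n) ℝ) :=
  {V | V ∈ feasSet U0 X0 X1 ∧ Jcost U0 X0 X1 Q R V ≤ a}

/-- The gradient `∇J(V) = 2 (Ū₀ᵀ R Ū₀ + X̄₁ᵀ P_V X̄₁) V Σ_V`. -/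
def gradJ (U0 : Matrix (Fin m) (Fin t) ℝ) (X0 X1 : Matrix (Fin n) (Fin t) ℝ)
    (Q : Matrix (Fin n) (Fin n) ℝ) (R : Matrix (Fin m) (Fin m) ℝ)
    (V : Matrix (Fin m ⊕ Fin n) (Fin n) ℝ) : Matrix (Fin m ⊕ Fin n) (Fin n) ℝ :=
  (2 : ℝ) • (((Ubar U0 X0)ᵀ * R * Ubar U0 X0 +
      (Xbar1 U0 X0 X1)ᵀ * PV U0 X0 X1 Q R V * Xbar1 U0 X0 X1) * V * SigV U0 X0 X1 V)

/-- `ξ(a) = ‖Ū₀‖² ‖R‖ + ‖X̄₁‖² a`. -/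
def xiC (U0 : Matrix (Fin m) (Fin t) ℝ) (X0 X1 : Matrix (Fin n) (Fin t) ℝ)
    (R : Matrix (Fin m) (Fin m) ℝ) (a : ℝ) : ℝ :=
  spNorm (Ubar U0 X0) ^ 2 * spNorm R + spNorm (Xbar1 U0 X0 X1) ^ 2 * a

/-- Smoothness constant `l(a)`. -/
def lC (U0 : Matrix (Fin m) (Fin t) ℝ) (X0 X1 : Matrix (Fin n) (Fin t) ℝ)
    (Q : Matrix (Fin n) (Fin n) ℝ) (R : Matrix (Fin m) (Fin m) ℝ) (a : ℝ) : ℝ :=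
  4 * a ^ 2 * (xiC U0 X0 X1 R a + a - sigMin Q) * frobNorm (Xbar1 U0 X0 X1) ^ 2 / sigMin Q ^ 2 +
    2 * xiC U0 X0 X1 R a * a / sigMin Q

/-- Gradient-dominance constant `μ(a) = 4a²/(σ̲(Q)^{3/2} σ̲(R)^{1/2} σ̲(Ū₀))`. -/
def muC (U0 : Matrix (Fin m) (Fin t) ℝ) (X0 : Matrix (Fin n) (Fin t) ℝ)
    (Q : Matrix (Fin n) (Fin n) ℝ) (R : Matrix (Fin m) (Fin m) ℝ) (a : ℝ) : ℝ :=
  4 * a ^ 2 / (Real.sqrt (sigMin Q) ^ 3 * Real.sqrt (sigMin R) * sigMin (Ubar U0 X0))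

/-- Reparameterized cost `f(L, Σ) = Tr(QΣ) + Tr(L Σ⁻¹ Lᵀ Ū₀ᵀ R Ū₀)`. -/
def fRep (U0 : Matrix (Fin m) (Fin t) ℝ) (X0 : Matrix (Fin n) (Fin t) ℝ)
    (Q : Matrix (Fin n) (Fin n) ℝ) (R : Matrix (Fin m) (Fin m) ℝ)
    (L : Matrix (Fin m ⊕ Fin n) (Fin n) ℝ) (Sg : Matrix (Fin n) (Fin n) ℝ) : ℝ :=
  Matrix.trace (Q * Sg) + Matrix.trace (L * Sg⁻¹ * Lᵀ * (Ubar U0 X0)ᵀ * R * Ubar U0 X0)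

/-- Feasible set `ℒ` of the convex reparameterization. -/
def repSet (U0 : Matrix (Fin m) (Fin t) ℝ) (X0 X1 : Matrix (Fin n) (Fin t) ℝ) :
    Set (Matrix (Fin m ⊕ Fin n) (Fin n) ℝ × Matrix (Fin n) (Fin n) ℝ) :=
  {p | p.2.IsSymm ∧ p.2 = Xbar0 U0 X0 * p.1 ∧
    (Matrix.fromBlocks (p.2 - 1) (Xbar1 U0 X0 X1 * p.1)
      ((Xbar1 U0 X0 X1 * p.1)ᵀ) p.2).PosSemidef}

/-- `p(a) = (16a³/(σ̲(Q)²ζ)) (1 + a/σ̲(Q)) (1 + √(a/σ̲(R)))`. -/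
def pC (Q : Matrix (Fin n) (Fin n) ℝ) (R : Matrix (Fin m) (Fin m) ℝ) (ζ a : ℝ) : ℝ :=
  16 * a ^ 3 / (sigMin Q ^ 2 * ζ) * (1 + a / sigMin Q) * (1 + Real.sqrt (a / sigMin R))

section LyapHelpers

open Filter Topology
open scoped Matrix.Norms.L2Operator RealInnerProductSpace ENNReal

theorem aux_eNorm {k : ℕ} (v : Fin k → ℝ) : eNorm v = ‖(WithLp.toLp 2 v : EuclideanSpace ℝ (Fin k))‖ := by
  simp [eNorm, EuclideanSpace.norm_eq]

theorem aux_spNorm {k : ℕ} [NeZero k] (M : Matrix (Fin k) (Fin k) ℝ) :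
    spNorm M = ‖Matrix.toEuclideanCLM (n := Fin k) (𝕜 := ℝ) M‖ := by
  rw [← ContinuousLinearMap.sSup_sphere_eq_norm, spNorm]
  congr 1
  ext r
  constructor
  · rintro ⟨v, hv, rfl⟩
    refine ⟨WithLp.toLp 2 v, ?_, ?_⟩
    · simpa [aux_eNorm] using hv
    · simp [aux_eNorm]
  · rintro ⟨x, hx, rfl⟩
    refine ⟨WithLp.ofLp x, ?_, ?_⟩
    · simpa [aux_eNorm] using hx
    · rw [aux_eNorm, ← Matrix.toEuclideanCLM_toLp]

theorem aux_entry {k : ℕ} (M : Matrix (Fin k) (Fin k) ℂ) (i j : Fin k) : ‖M i j‖ ≤ ‖M‖ := by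
  have h := Matrix.l2_opNorm_mulVec M (EuclideanSpace.single j (1 : ℂ))
  have h2 := PiLp.norm_apply_le (WithLp.toLp 2 (M *ᵥ (EuclideanSpace.single j (1 : ℂ)).ofLp) : EuclideanSpace ℂ (Fin k)) i
  simp at h h2
  exact h2.trans h

theorem aux_summable {k : ℕ} (M : Matrix (Fin k) (Fin k) ℝ) (hM : specLt1 M) :
    Summable (fun i : ℕ => M ^ i * (Mᵀ) ^ i) := by
  unfold specLt1 at hM
  obtain ⟨r, hr1, hr2⟩ := ENNReal.lt_iff_exists_nnreal_btwn.1 hM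
  have hr2' : r < 1 := by exact_mod_cast hr2
  have hg := spectrum.pow_nnnorm_pow_one_div_tendsto_nhds_spectralRadius (M.map Complex.ofReal)
  have hev : ∀ᶠ i : ℕ in atTop, ∀ p q, |(M ^ i) p q| ≤ (r : ℝ) ^ i := by
    filter_upwards [hg.eventually (gt_mem_nhds hr1), eventually_gt_atTop 0] with i hi hi0 p q
    have h1 : ‖(M.map Complex.ofReal) ^ i‖₊ ≤ r ^ i := by
      have h2 := ENNReal.rpow_le_rpow hi.le (Nat.cast_nonneg i : (0 : ℝ) ≤ i)
      rw [← ENNReal.rpow_mul, one_div, inv_mul_cancel₀ (by positivity), ENNReal.rpow_one,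
        ENNReal.rpow_natCast] at h2
      exact_mod_cast h2
    have h3 := aux_entry ((M.map Complex.ofReal) ^ i) p q
    have h4 : (M.map Complex.ofReal) ^ i = (M ^ i).map Complex.ofReal :=
      (map_pow (Complex.ofRealHom.mapMatrix) M i).symm
    rw [h4] at h3
    rw [h4] at h1
    have h5 : ‖(M ^ i).map Complex.ofReal‖ ≤ (r : ℝ) ^ i := by exact_mod_cast h1
    simpa using h3.trans h5
  refine Pi.summable.2 fun p => Pi.summable.2 fun q => ?_
  have hgeo : Summable (fun i : ℕ => (k : ℝ) * ((r : ℝ) ^ 2) ^ i) :=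
    (summable_geometric_of_lt_one (by positivity)
      (pow_lt_one₀ r.2 (by exact_mod_cast hr2') two_ne_zero)).mul_left _
  refine Summable.of_norm_bounded_eventually_nat hgeo ?_
  filter_upwards [hev] with i hi
  rw [← Matrix.transpose_pow, Matrix.mul_apply]
  refine (norm_sum_le _ _).trans ?_
  calc _ ≤ ∑ _l : Fin k, ((r : ℝ) ^ 2) ^ i := by
        refine Finset.sum_le_sum fun l _ => ?_
        rw [norm_mul, Matrix.transpose_apply, Real.norm_eq_abs, Real.norm_eq_abs, ← pow_mul, mul_comm 2 i,
          pow_mul, sq]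
        exact mul_le_mul (hi p l) (hi q l) (abs_nonneg _) (by positivity)
    _ = _ := by simp

theorem aux_specLt1 {k : ℕ} (M : Matrix (Fin k) (Fin k) ℝ)
    (hM : Tendsto (fun i : ℕ => M ^ i) atTop (𝓝 0)) : specLt1 M := by
  unfold specLt1
  have hc : Tendsto (fun i : ℕ => (M.map Complex.ofReal) ^ i) atTop (𝓝 0) := by
    have h4 : ∀ i, (M.map Complex.ofReal) ^ i = (M ^ i).map Complex.ofReal := fun i =>
      (map_pow (Complex.ofRealHom.mapMatrix) M i).symm
    simp_rw [h4]
    have hcont : Continuous (fun N : Matrix (Fin k) (Fin k) ℝ => N.map Complex.ofReal) :=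
      Continuous.matrix_map continuous_id Complex.continuous_ofReal
    have := (hcont.tendsto 0).comp hM
    simpa [Function.comp_def] using this
  have hn : Tendsto (fun i : ℕ => ‖(M.map Complex.ofReal) ^ i‖₊ * ‖(1 : Matrix (Fin k) (Fin k) ℂ)‖₊)
      atTop (𝓝 0) := by
    simpa using hc.nnnorm.mul_const ‖(1 : Matrix (Fin k) (Fin k) ℂ)‖₊
  obtain ⟨N, hN⟩ := eventually_atTop.1 (hn.eventually (gt_mem_nhds (zero_lt_one)))
  refine (spectrum.spectralRadius_le_pow_nnnorm_pow_one_div ℂ (M.map Complex.ofReal) N).trans_lt ?_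
  rw [← ENNReal.mul_rpow_of_nonneg _ _ (by positivity)]
  refine ENNReal.rpow_lt_one ?_ (by positivity)
  exact_mod_cast hN (N + 1) (by omega)

section Abs

variable {E : Type*} [NormedAddCommGroup E] [InnerProductSpace ℝ E] [CompleteSpace E]

theorem aux_inner_pow (T : E →L[ℝ] E) (i : ℕ) (w v : E) :
    ⟪w, (T ^ i * (star T) ^ i) v⟫ = ⟪((star T) ^ i) w, ((star T) ^ i) v⟫ := by
  rw [← star_pow, ContinuousLinearMap.star_eq_adjoint, ContinuousLinearMap.adjoint_inner_left]
  rfl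

theorem aux_hasSum {T S : E →L[ℝ] E} (hS : HasSum (fun i : ℕ => T ^ i * (star T) ^ i) S) (w v : E) :
    HasSum (fun i : ℕ => ⟪((star T) ^ i) w, ((star T) ^ i) v⟫) ⟪w, S v⟫ := by
  simp_rw [← aux_inner_pow]
  have h1 : HasSum (fun i : ℕ => (T ^ i * (star T) ^ i) v) (S v) :=
    hS.map (ContinuousLinearMap.apply ℝ E v : (E →L[ℝ] E) →L[ℝ] E)
      (ContinuousLinearMap.apply ℝ E v : (E →L[ℝ] E) →L[ℝ] E).continuous
  exact h1.map (innerSL ℝ w) (innerSL ℝ w).continuous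

theorem aux_lyap_eq {T S : E →L[ℝ] E} (hS : HasSum (fun i : ℕ => T ^ i * (star T) ^ i) S) :
    S = 1 + T * S * star T := by
  have h1 : HasSum (fun i : ℕ => T ^ (i + 1) * (star T) ^ (i + 1)) (T * S * star T) := by
    have := (hS.mul_left T).mul_right (star T)
    have heq : (fun i : ℕ => T ^ (i + 1) * (star T) ^ (i + 1)) =
        fun i : ℕ => T * (T ^ i * (star T) ^ i) * star T := by
      funext i
      rw [pow_succ', pow_succ]
      simp only [mul_assoc]
    rw [heq]
    exact this
  have h2 := (hasSum_nat_add_iff' (f := fun i : ℕ => T ^ i * (star T) ^ i) 1).2 hS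
  have := h1.unique h2
  rw [this]; simp

theorem aux_psd {T S : E →L[ℝ] E} (hS : HasSum (fun i : ℕ => T ^ i * (star T) ^ i) S) (v : E) :
    0 ≤ ⟪v, S v⟫ :=
  (aux_hasSum hS v v).nonneg fun i => real_inner_self_nonneg

theorem aux_one_le [Nontrivial E] {T S : E →L[ℝ] E}
    (hS : HasSum (fun i : ℕ => T ^ i * (star T) ^ i) S) : 1 ≤ ‖S‖ := by
  obtain ⟨v, hv⟩ := exists_norm_eq E zero_le_one
  have h1 := le_hasSum (aux_hasSum hS v v) 0 (fun i _ => real_inner_self_nonneg)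
  simp only [pow_zero, ContinuousLinearMap.one_apply, real_inner_self_eq_norm_sq] at h1
  have h2 := real_inner_le_norm v (S v)
  have h3 := S.le_opNorm v
  rw [hv] at *
  linarith

theorem aux_telescope {B S F : E →L[ℝ] E}
    (h : ∀ w v, ⟪w, S v⟫ - ⟪B w, S (B v)⟫ = ⟪w, v⟫ - ⟪w, F v⟫) (k : ℕ) (w v : E) :
    ⟪w, S v⟫ - ⟪(B ^ k) w, S ((B ^ k) v)⟫ =
      ∑ i ∈ Finset.range k, (⟪(B ^ i) w, (B ^ i) v⟫ - ⟪(B ^ i) w, F ((B ^ i) v)⟫) := by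
  induction k with
  | zero => simp
  | succ k ih =>
    rw [Finset.sum_range_succ, ← ih, ← h, pow_succ']
    simp

theorem aux_sum_le {B S F : E →L[ℝ] E} (hpos : ∀ v, 0 ≤ ⟪v, S v⟫) (hF : ‖F‖ ≤ 1 / 2)
    (h : ∀ w v, ⟪w, S v⟫ - ⟪B w, S (B v)⟫ = ⟪w, v⟫ - ⟪w, F v⟫) (k : ℕ) (v : E) :
    ∑ i ∈ Finset.range k, ‖(B ^ i) v‖ ^ 2 ≤ 2 * ‖S‖ * ‖v‖ ^ 2 := by
  have h1 := aux_telescope h k v v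
  have h2 : ∑ i ∈ Finset.range k, (1 / 2 * ‖(B ^ i) v‖ ^ 2) ≤
      ∑ i ∈ Finset.range k, (⟪(B ^ i) v, (B ^ i) v⟫ - ⟪(B ^ i) v, F ((B ^ i) v)⟫) := by
    refine Finset.sum_le_sum fun i _ => ?_
    set x := (B ^ i) v
    have h3 := real_inner_le_norm x (F x)
    have h4 := F.le_of_opNorm_le hF x
    rw [real_inner_self_eq_norm_sq]
    nlinarith [norm_nonneg x]
  rw [← Finset.mul_sum] at h2
  have h5 := hpos ((B ^ k) v)
  have h6 := real_inner_le_norm v (S v)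
  have h7 := S.le_opNorm v
  nlinarith [norm_nonneg v]

theorem aux_diff {B S S' F : E →L[ℝ] E} (hpos : ∀ v, 0 ≤ ⟪v, S v⟫) (hF : ‖F‖ ≤ 1 / 2)
    (h : ∀ w v, ⟪w, S v⟫ - ⟪B w, S (B v)⟫ = ⟪w, v⟫ - ⟪w, F v⟫)
    (hS' : ∀ w v, HasSum (fun i : ℕ => ⟪(B ^ i) w, (B ^ i) v⟫) ⟪w, S' v⟫) :
    ‖S' - S‖ ≤ 2 * ‖S‖ * ‖F‖ := by
  have hz : ∀ v, Tendsto (fun i : ℕ => (B ^ i) v) atTop (𝓝 0) := by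
    intro v
    have h1 := (hS' v v).summable.tendsto_atTop_zero
    simp_rw [real_inner_self_eq_norm_sq] at h1
    rw [tendsto_zero_iff_norm_tendsto_zero]
    have := h1.sqrt
    simpa using this
  have key : ∀ w v, ⟪w, (S' - S) v⟫ ≤ ‖F‖ * (2 * ‖S‖) * ((‖w‖ ^ 2 + ‖v‖ ^ 2) / 2) := by
    intro w v
    have hl : Tendsto (fun k : ℕ => ∑ i ∈ Finset.range k, ⟪(B ^ i) w, (B ^ i) v⟫ -
        (⟪w, S v⟫ - ⟪(B ^ k) w, S ((B ^ k) v)⟫)) atTop (𝓝 (⟪w, S' v⟫ - (⟪w, S v⟫ - ⟪(0 : E), S 0⟫))) := by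
      refine (hS' w v).tendsto_sum_nat.sub (tendsto_const_nhds.sub ?_)
      exact (hz w).inner ((S.continuous.tendsto 0).comp (hz v))
    simp only [inner_zero_left, sub_zero] at hl
    rw [ContinuousLinearMap.sub_apply, inner_sub_right]
    refine le_of_tendsto' hl fun k => ?_
    rw [aux_telescope h, ← Finset.sum_sub_distrib]
    calc _ ≤ ∑ i ∈ Finset.range k, ‖F‖ * ((‖(B ^ i) w‖ ^ 2 + ‖(B ^ i) v‖ ^ 2) / 2) := by
          refine Finset.sum_le_sum fun i _ => ?_
          rw [sub_sub_cancel]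
          have h3 := real_inner_le_norm ((B ^ i) w) (F ((B ^ i) v))
          have h4 := F.le_opNorm ((B ^ i) v)
          have h5 : ‖(B ^ i) w‖ * ‖F ((B ^ i) v)‖ ≤ ‖(B ^ i) w‖ * (‖F‖ * ‖(B ^ i) v‖) := by gcongr
          nlinarith [mul_nonneg (norm_nonneg F) (sq_nonneg (‖(B ^ i) w‖ - ‖(B ^ i) v‖))]
      _ ≤ _ := by
          rw [← Finset.mul_sum, ← Finset.sum_div, Finset.sum_add_distrib, mul_assoc]
          have h1 := aux_sum_le hpos hF h k w
          have h2 := aux_sum_le hpos hF h k v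
          gcongr
          linarith
  refine ContinuousLinearMap.opNorm_le_of_unit_norm (by positivity) fun v hv => ?_
  by_cases h0 : (S' - S) v = 0
  · rw [h0, norm_zero]; positivity
  have hk := key (‖(S' - S) v‖⁻¹ • (S' - S) v) v
  have hn : ‖(S' - S) v‖ ≠ 0 := norm_ne_zero_iff.2 h0
  rw [real_inner_smul_left, real_inner_self_eq_norm_sq, norm_smul, norm_inv, norm_norm,
    inv_mul_cancel₀ hn, hv, sq, inv_mul_cancel_left₀ hn] at hk
  linarith

theorem aux_F {T T' S : E →L[ℝ] E} (hs1 : 1 ≤ ‖S‖)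
    (hd : ‖T' - T‖ ≤ 1 / (4 * ‖S‖ * (1 + ‖T‖))) :
    ‖T' * S * star T' - T * S * star T‖ ≤ 2 * ‖S‖ * (1 + ‖T‖) * ‖T' - T‖ ∧
    ‖T' * S * star T' - T * S * star T‖ ≤ 1 / 2 := by
  have he : T' * S * star T' - T * S * star T =
      T * S * star (T' - T) + (T' - T) * S * star T + (T' - T) * S * star (T' - T) := by
    rw [star_sub]; noncomm_ring
  have n3 : ∀ X Y : E →L[ℝ] E, ‖X * S * star Y‖ ≤ ‖X‖ * ‖S‖ * ‖Y‖ := by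
    intro X Y
    refine (norm_mul_le _ _).trans ?_
    rw [ContinuousLinearMap.star_eq_adjoint, LinearIsometryEquiv.norm_map]
    gcongr
    exact norm_mul_le _ _
  have hb : ‖T' * S * star T' - T * S * star T‖ ≤
      ‖T‖ * ‖S‖ * ‖T' - T‖ + ‖T' - T‖ * ‖S‖ * ‖T‖ + ‖T' - T‖ * ‖S‖ * ‖T' - T‖ := by
    rw [he]
    exact (norm_add₃_le).trans (add_le_add (add_le_add (n3 _ _) (n3 _ _)) (n3 _ _))
  generalize ‖T' * S * star T' - T * S * star T‖ = e at *
  have ha := norm_nonneg T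
  have hd0 := norm_nonneg (T' - T)
  generalize ‖T‖ = a at *
  generalize ‖T' - T‖ = d at *
  generalize ‖S‖ = s at *
  rw [le_div_iff₀ (by positivity)] at hd
  have hd1 : d ≤ 1 := by
    have : d * 1 ≤ d * (4 * s * (1 + a)) := by
      gcongr
      nlinarith
    linarith
  have h1 : e ≤ 2 * s * (1 + a) * d := by
    have : d * s * d ≤ d * s * 1 := by gcongr
    nlinarith [mul_nonneg hd0 (zero_le_one.trans hs1)]
  exact ⟨h1, by nlinarith⟩

end Abs

theorem aux_main {k : ℕ} [NeZero k] (A A' : Matrix (Fin k) (Fin k) ℝ) (hA : specLt1 A)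
    (h : spNorm (A' - A) ≤ 1 / (4 * spNorm (lyap A) * (1 + spNorm A))) :
    specLt1 A' ∧
    spNorm (lyap A' - lyap A) ≤
      4 * spNorm (lyap A) ^ 2 * (1 + spNorm A) * spNorm (A' - A) := by
  have hφc : Continuous (Matrix.toEuclideanCLM (n := Fin k) (𝕜 := ℝ)) :=
    LinearMap.continuous_of_finiteDimensional
      (Matrix.toEuclideanCLM (n := Fin k) (𝕜 := ℝ)).toAlgEquiv.toLinearMap
  have hφs : ∀ M : Matrix (Fin k) (Fin k) ℝ, Matrix.toEuclideanCLM (n := Fin k) (𝕜 := ℝ) Mᵀ =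
      star (Matrix.toEuclideanCLM (n := Fin k) (𝕜 := ℝ) M) := by
    intro M
    rw [← map_star, Matrix.star_eq_conjTranspose, Matrix.conjTranspose_eq_transpose_of_trivial]
  have hsum : ∀ M : Matrix (Fin k) (Fin k) ℝ, specLt1 M →
      HasSum (fun i : ℕ => (Matrix.toEuclideanCLM (n := Fin k) (𝕜 := ℝ) M) ^ i *
        (star (Matrix.toEuclideanCLM (n := Fin k) (𝕜 := ℝ) M)) ^ i)
        (Matrix.toEuclideanCLM (n := Fin k) (𝕜 := ℝ) (lyap M)) := by
    intro M hM
    have := (aux_summable M hM).hasSum.map (Matrix.toEuclideanCLM (n := Fin k) (𝕜 := ℝ)) hφc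
    have heq : (fun i : ℕ => (Matrix.toEuclideanCLM (n := Fin k) (𝕜 := ℝ) M) ^ i *
        (star (Matrix.toEuclideanCLM (n := Fin k) (𝕜 := ℝ) M)) ^ i) =
        (Matrix.toEuclideanCLM (n := Fin k) (𝕜 := ℝ)) ∘ fun i : ℕ => M ^ i * Mᵀ ^ i := by
      funext i
      simp [map_mul, map_pow, hφs]
    rw [heq]
    exact this
  simp only [aux_spNorm, map_sub] at h ⊢
  have hS := hsum A hA
  have hs' := hsum A'
  have hspec := aux_specLt1 A'
  have hφA' := hφs A'
  set S := Matrix.toEuclideanCLM (n := Fin k) (𝕜 := ℝ) (lyap A)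
  set T := Matrix.toEuclideanCLM (n := Fin k) (𝕜 := ℝ) A
  set T' := Matrix.toEuclideanCLM (n := Fin k) (𝕜 := ℝ) A' with hT'
  obtain ⟨hF1, hF2⟩ := aux_F (aux_one_le hS) h
  have hpos := aux_psd hS
  have hrec : ∀ w v, ⟪w, S v⟫ - ⟪(star T') w, S ((star T') v)⟫ =
      ⟪w, v⟫ - ⟪w, (T' * S * star T' - T * S * star T) v⟫ := by
    intro w v
    have h1 : S v = v + (T * S * star T) v := by
      conv_lhs => rw [aux_lyap_eq hS]
      rfl
    rw [ContinuousLinearMap.star_eq_adjoint T', ContinuousLinearMap.adjoint_inner_left, h1,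
      ContinuousLinearMap.sub_apply, inner_sub_right, inner_add_right]
    simp only [ContinuousLinearMap.mul_apply]
    ring
  have hsp : specLt1 A' := by
    refine hspec ?_
    have hzero : ∀ v, Tendsto (fun i : ℕ => ((star T') ^ i) v) atTop (𝓝 0) := by
      intro v
      have h1 : Summable (fun i : ℕ => ‖((star T') ^ i) v‖ ^ 2) :=
        summable_of_sum_range_le (fun i => sq_nonneg _) (fun j => aux_sum_le hpos hF2 hrec j v)
      rw [tendsto_zero_iff_norm_tendsto_zero]
      simpa using h1.tendsto_atTop_zero.sqrt
    refine tendsto_pi_nhds.2 fun p => tendsto_pi_nhds.2 fun q => ?_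
    have h2 := hzero (EuclideanSpace.single p 1)
    have h3 := ((EuclideanSpace.proj q : EuclideanSpace ℝ (Fin k) →L[ℝ] ℝ).continuous.tendsto _).comp h2
    rw [← hφA', map_zero] at h3
    refine h3.congr fun i => ?_
    rw [Function.comp_apply, ← map_pow, ← Matrix.transpose_pow]
    generalize A' ^ i = N
    simp
  refine ⟨hsp, ?_⟩
  have hfin := aux_diff hpos hF2 hrec (aux_hasSum (hs' hsp))
  refine hfin.trans ?_
  calc 2 * ‖S‖ * _ ≤ 2 * ‖S‖ * (2 * ‖S‖ * (1 + ‖T‖) * ‖T' - T‖) := by gcongr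
    _ = _ := by ring

end LyapHelpers

/-- Perturbation of discrete Lyapunov equations (Lemma 13). -/
theorem stmt_11 {n : ℕ} (A A' : Matrix (Fin n) (Fin n) ℝ) (hA : specLt1 A)
    (h : spNorm (A' - A) ≤ 1 / (4 * spNorm (lyap A) * (1 + spNorm A))) :
    specLt1 A' ∧
    spNorm (lyap A' - lyap A) ≤
      4 * spNorm (lyap A) ^ 2 * (1 + spNorm A) * spNorm (A' - A) := by
  rcases Nat.eq_zero_or_pos n with h0 | h0
  · subst h0
    constructor
    · unfold specLt1
      rw [Subsingleton.elim (A'.map Complex.ofReal) 0]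
      simp [spectralRadius, spectrum.of_subsingleton]
    · have hz : ∀ M : Matrix (Fin 0) (Fin 0) ℝ, spNorm M = 0 := by
        intro M
        simp [spNorm, eNorm]
      simp [hz]
  · haveI : NeZero n := ⟨h0.ne'⟩
    exact aux_main A A' hA h
end
end

section
/- Closed-loop parameterization error identity and bound: suppose the data satisfy X₁ = AX₀ + BU₀ + W₀ for matrices A ∈ ℝ^{n×n}, B ∈ ℝ^{n×m}, W₀ ∈ ℝ^{n×t}. For any K ∈ ℝ^{m×n}, setting V := Φ⁻¹[Kᵀ, Iₙ]ᵀ, one has the identity A + BK − X̄₁V = −W₀D₀†[Kᵀ, Iₙ]ᵀ. Consequently, if in addition σ̲(D₀) ≥ √t·γζ/2 for constants γ, ζ > 0 and every column of W₀ has Euclidean norm at most δ, then ‖A + BK − X̄₁V‖ ≤ 2(1 + ‖K‖)δ/(γζ). -/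
open Matrix

noncomputable section

variable {n m t : ℕ}

/-- Euclidean norm as the norm of Mathlib's Euclidean space. -/
lemma eNorm_eq_norm {ι : Type*} [Fintype ι] (v : ι → ℝ) : eNorm v = ‖WithLp.toLp 2 v‖ := by
  simp [eNorm, EuclideanSpace.norm_eq]

lemma eNorm_nonneg {ι : Type*} [Fintype ι] (v : ι → ℝ) : 0 ≤ eNorm v := Real.sqrt_nonneg _

lemma eNorm_smul {ι : Type*} [Fintype ι] (c : ℝ) (v : ι → ℝ) :
    eNorm (c • v) = |c| * eNorm v := by
  rw [eNorm_eq_norm, eNorm_eq_norm, WithLp.toLp_smul, norm_smul, Real.norm_eq_abs]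

lemma eNorm_sq {ι : Type*} [Fintype ι] (v : ι → ℝ) : eNorm v ^ 2 = v ⬝ᵥ v := by
  rw [eNorm, Real.sq_sqrt (Finset.sum_nonneg fun i _ => sq_nonneg _)]
  simp [dotProduct, sq]

lemma dot_le {ι : Type*} [Fintype ι] (u v : ι → ℝ) : u ⬝ᵥ v ≤ eNorm u * eNorm v := by
  simpa [dotProduct, eNorm] using Real.sum_mul_le_sqrt_mul_sqrt Finset.univ u v

lemma eNorm_mulVec_le {ι κ : Type*} [Fintype ι] [Fintype κ] (W : Matrix ι κ ℝ) (δ : ℝ)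
    (hδ : 0 ≤ δ) (h : ∀ j, eNorm (fun i => W i j) ≤ δ) (y : κ → ℝ) :
    eNorm (W *ᵥ y) ≤ Real.sqrt (Fintype.card κ) * δ * eNorm y := by
  have h1 : eNorm (W *ᵥ y) ≤ ∑ j, |y j| * δ := by
    have : WithLp.toLp 2 (W *ᵥ y) = ∑ j, y j • WithLp.toLp 2 (fun i => W i j) := by
      ext i
      simp [mulVec, dotProduct, mul_comm]
    rw [eNorm_eq_norm, this]
    refine (norm_sum_le _ _).trans (Finset.sum_le_sum fun j _ => ?_)
    rw [norm_smul, Real.norm_eq_abs, ← eNorm_eq_norm]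
    exact mul_le_mul_of_nonneg_left (h j) (abs_nonneg _)
  have h2 : ∑ j, |y j| ≤ Real.sqrt (Fintype.card κ) * eNorm y := by
    simpa [eNorm] using Real.sum_mul_le_sqrt_mul_sqrt Finset.univ (fun _ : κ => (1:ℝ)) (fun j => |y j|)
  rw [← Finset.sum_mul] at h1
  nlinarith [mul_le_mul_of_nonneg_right h2 hδ]

lemma eNorm_mulVec_le_spNorm {ι κ : Type*} [Fintype ι] [Fintype κ] (K : Matrix ι κ ℝ)
    (v : κ → ℝ) (hv : eNorm v = 1) : eNorm (K *ᵥ v) ≤ spNorm K := by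
  refine le_csSup (s := {r : ℝ | ∃ v : κ → ℝ, eNorm v = 1 ∧ r = eNorm (K.mulVec v)}) ?_ ⟨v, hv, rfl⟩
  refine ⟨Real.sqrt (Fintype.card κ) * ∑ j, eNorm (fun i => K i j), ?_⟩
  rintro r ⟨w, hw, rfl⟩
  have := eNorm_mulVec_le K (∑ j, eNorm (fun i => K i j))
    (Finset.sum_nonneg fun j _ => eNorm_nonneg _)
    (fun j => Finset.single_le_sum (f := fun j => eNorm (fun i => K i j))
      (fun j _ => eNorm_nonneg _) (Finset.mem_univ j)) w
  simpa [hw] using this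

lemma spNorm_nonneg {ι κ : Type*} [Fintype ι] [Fintype κ] (K : Matrix ι κ ℝ) : 0 ≤ spNorm K := by
  apply Real.sSup_nonneg
  rintro r ⟨v, _, rfl⟩
  exact eNorm_nonneg _

lemma sigMin_mul_le {ι κ : Type*} [Fintype ι] [Fintype κ] (D : Matrix ι κ ℝ) (u : ι → ℝ) :
    sigMin D * eNorm u ≤ eNorm (u ᵥ* D) := by
  rcases (eNorm_nonneg u).eq_or_lt with h | h
  · rw [← h, mul_zero]; exact eNorm_nonneg _
  · have h1 : sigMin D ≤ eNorm (((eNorm u)⁻¹ • u) ᵥ* D) := by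
      apply csInf_le
      · refine ⟨0, ?_⟩
        rintro r ⟨w, _, rfl⟩
        exact eNorm_nonneg _
      · refine ⟨_, ?_, rfl⟩
        rw [eNorm_smul, abs_of_pos (inv_pos.2 h), inv_mul_cancel₀ h.ne']
    rw [smul_vecMul, eNorm_smul, abs_of_pos (inv_pos.2 h), inv_mul_eq_div, le_div_iff₀ h] at h1
    exact h1

lemma sigMin_pinv {ι κ : Type*} [Fintype ι] [Fintype κ] [DecidableEq ι] (D : Matrix ι κ ℝ)
    (hD : D * pinv D = 1) (hs : 0 ≤ sigMin D) (w : ι → ℝ) :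
    sigMin D * eNorm (pinv D *ᵥ w) ≤ eNorm w := by
  set u := (D * Dᵀ)⁻¹ *ᵥ w with hu
  have hy : pinv D *ᵥ w = u ᵥ* D := by
    rw [pinv, ← mulVec_mulVec, mulVec_transpose]
  have hw : D *ᵥ (u ᵥ* D) = w := by
    rw [← hy, mulVec_mulVec, hD, one_mulVec]
  have h1 := sigMin_mul_le D u
  have h2 : eNorm (u ᵥ* D) ^ 2 ≤ eNorm u * eNorm w := by
    rw [eNorm_sq, ← dotProduct_mulVec, hw]
    exact dot_le u w
  rw [hy]
  rcases (eNorm_nonneg (u ᵥ* D)).eq_or_lt with h | h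
  · rw [← h, mul_zero]; exact eNorm_nonneg _
  · have h3 := mul_le_mul_of_nonneg_right h1 (eNorm_nonneg w)
    have h4 := mul_le_mul_of_nonneg_left h2 hs
    refine le_of_mul_le_mul_right ?_ h
    nlinarith

lemma eNorm_fromRows {n m : ℕ} (K : Matrix (Fin m) (Fin n) ℝ) (v : Fin n → ℝ)
    (hv : eNorm v = 1) :
    eNorm (fromRows K (1 : Matrix (Fin n) (Fin n) ℝ) *ᵥ v) ≤ 1 + spNorm K := by
  have h1 := eNorm_mulVec_le_spNorm K v hv
  have h2 := eNorm_nonneg (K *ᵥ v)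
  have h3 : eNorm (fromRows K (1 : Matrix (Fin n) (Fin n) ℝ) *ᵥ v) ^ 2
      = eNorm (K *ᵥ v) ^ 2 + eNorm v ^ 2 := by
    simp [eNorm_sq, fromRows_mulVec, dotProduct]
  rw [hv] at h3
  have h4 := eNorm_nonneg (fromRows K (1 : Matrix (Fin n) (Fin n) ℝ) *ᵥ v)
  nlinarith

/-- Closed-loop parameterization error identity and bound (equations (21)-(23)). -/
theorem stmt_15 {n m t : ℕ} (hn : 0 < n) (hm : 0 < m) (ht : 0 < t)
    (U0 : Matrix (Fin m) (Fin t) ℝ) (X0 X1 : Matrix (Fin n) (Fin t) ℝ)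
    (hrank : (Dmat U0 X0).rank = m + n)
    (A : Matrix (Fin n) (Fin n) ℝ) (B : Matrix (Fin n) (Fin m) ℝ)
    (W0 : Matrix (Fin n) (Fin t) ℝ)
    (hdyn : X1 = A * X0 + B * U0 + W0)
    (K : Matrix (Fin m) (Fin n) ℝ) :
    A + B * K -
        Xbar1 U0 X0 X1 * ((Phi U0 X0)⁻¹ * Matrix.fromRows K (1 : Matrix (Fin n) (Fin n) ℝ)) =
      -(W0 * pinv (Dmat U0 X0) * Matrix.fromRows K (1 : Matrix (Fin n) (Fin n) ℝ)) ∧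
    ∀ γ ζ δ : ℝ, 0 < γ → 0 < ζ →
      sigMin (Dmat U0 X0) ≥ Real.sqrt t * γ * ζ / 2 →
      (∀ j, eNorm (fun i => W0 i j) ≤ δ) →
      spNorm (A + B * K -
          Xbar1 U0 X0 X1 *
            ((Phi U0 X0)⁻¹ * Matrix.fromRows K (1 : Matrix (Fin n) (Fin n) ℝ))) ≤
        2 * (1 + spNorm K) * δ / (γ * ζ) := by
  set D := Dmat U0 X0 with hDdef
  have hdet : IsUnit (D * Dᵀ) := by
    have hr : (D * Dᵀ).rank = m + n := by rw [rank_self_mul_transpose, hrank]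
    have htop : LinearMap.range (D * Dᵀ).mulVecLin = ⊤ := by
      apply Submodule.eq_top_of_finrank_eq
      rw [← Matrix.rank, hr]
      simp
    exact mulVec_surjective_iff_isUnit.1 (LinearMap.range_eq_top.1 htop)
  have hdet' : IsUnit (D * Dᵀ).det := (isUnit_iff_isUnit_det _).1 hdet
  have hD : D * pinv D = 1 := by
    rw [pinv, ← Matrix.mul_assoc, mul_nonsing_inv _ hdet']
  have ht' : (t : ℝ) ≠ 0 := by positivity
  have hX : Xbar1 U0 X0 X1 * (Phi U0 X0)⁻¹ = X1 * pinv D := by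
    have hinv : (Phi U0 X0)⁻¹ = (t : ℝ) • (D * Dᵀ)⁻¹ := by
      apply inv_eq_left_inv
      rw [Phi, ← hDdef, Matrix.smul_mul, Matrix.mul_smul, nonsing_inv_mul _ hdet', smul_smul,
        mul_inv_cancel₀ ht', one_smul]
    rw [hinv, Xbar1, ← hDdef, Matrix.smul_mul, Matrix.mul_smul, smul_smul,
      inv_mul_cancel₀ ht', one_smul, pinv, Matrix.mul_assoc]
  have hAB : A * X0 + B * U0 = fromCols B A * D := by
    rw [hDdef, Dmat, fromCols_mul_fromRows, add_comm]
  have hid : A + B * K -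
        Xbar1 U0 X0 X1 * ((Phi U0 X0)⁻¹ * Matrix.fromRows K (1 : Matrix (Fin n) (Fin n) ℝ)) =
      -(W0 * pinv D * Matrix.fromRows K (1 : Matrix (Fin n) (Fin n) ℝ)) := by
    rw [← Matrix.mul_assoc, hX, hdyn, hAB, Matrix.add_mul, Matrix.mul_assoc _ D, hD,
      Matrix.mul_one, Matrix.add_mul, fromCols_mul_fromRows, Matrix.mul_one]
    abel
  refine ⟨hid, ?_⟩
  intro γ ζ δ hγ hζ hσ hW
  rw [hid]
  have hδ : 0 ≤ δ := (eNorm_nonneg _).trans (hW ⟨0, ht⟩)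
  have hK := spNorm_nonneg K
  have hst : 0 < Real.sqrt t := Real.sqrt_pos.2 (by positivity)
  have hs0 : 0 < sigMin D := lt_of_lt_of_le (by positivity) hσ
  apply Real.sSup_le _ (by positivity)
  rintro r ⟨v, hv, rfl⟩
  set w := fromRows K (1 : Matrix (Fin n) (Fin n) ℝ) *ᵥ v with hw
  have e1 : eNorm (-(W0 * pinv D * fromRows K (1 : Matrix (Fin n) (Fin n) ℝ)) *ᵥ v)
      = eNorm (W0 *ᵥ (pinv D *ᵥ w)) := by
    rw [neg_mulVec, hw, mulVec_mulVec, mulVec_mulVec, ← neg_one_smul ℝ, eNorm_smul]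
    simp
  rw [e1]
  have b1 := eNorm_mulVec_le W0 δ hδ hW (pinv D *ᵥ w)
  rw [Fintype.card_fin] at b1
  have b2 := sigMin_pinv D hD hs0.le w
  have b3 : eNorm w ≤ 1 + spNorm K := eNorm_fromRows K v hv
  have b4 : Real.sqrt t * γ * ζ / 2 * eNorm (pinv D *ᵥ w) ≤ 1 + spNorm K :=
    ((mul_le_mul_of_nonneg_right hσ (eNorm_nonneg _)).trans b2).trans b3
  rw [le_div_iff₀ (by positivity)]
  have b5 := mul_le_mul_of_nonneg_right b1 (by positivity : 0 ≤ γ * ζ)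
  have b6 := mul_le_mul_of_nonneg_right b4 hδ
  nlinarith
end
end

section
/- Optimal-value gap between the data-driven and true LQR problems: let (A, B) be controllable with A ∈ ℝ^{n×n}, B ∈ ℝ^{n×m}. There exist constants c₁, c₂ > 0 depending only on n, A, B, Q, R such that for any constants γ, ζ, δ > 0 and any data U₀, X₀, W₀, X₁ with X₁ = AX₀ + BU₀ + W₀, D₀ of full row rank, σ̲(D₀) ≥ √t·γζ/2, and every column of W₀ of Euclidean norm at most δ: if δ/γ ≤ c₁ζ, then the feasible set S is nonempty and |J* − C*| ≤ c₂δ/(γζ), where C* is the optimal LQR cost of the true system, C* := min{Tr((Q + KᵀRK)Σ_K) : K ∈ ℝ^{m×n}, ρ(A + BK) < 1, Σ_K = Iₙ + (A + BK)Σ_K(A + BK)ᵀ}. -/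
open Matrix

noncomputable section

variable {n m t : ℕ}

section Helpers

attribute [local instance] Matrix.frobeniusNormedAddCommGroup Matrix.frobeniusNormedSpace
  Matrix.frobeniusNormedRing Matrix.frobeniusNormedAlgebra

open Filter Topology

theorem h_map_pow {k : ℕ} (M : Matrix (Fin k) (Fin k) ℝ) (i : ℕ) :
    (M.map Complex.ofReal) ^ i = (M ^ i).map Complex.ofReal := by
  have := map_pow (Complex.ofRealHom.mapMatrix (m := Fin k)) M i
  exact this.symm

theorem h_norm_map {k : ℕ} (M : Matrix (Fin k) (Fin k) ℝ) :
    ‖M.map Complex.ofReal‖ = ‖M‖ :=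
  Matrix.frobenius_norm_map_eq M Complex.ofReal (fun a => by simp)

/-- small power implies spectral radius below one -/
theorem h_specLt1_of_pow {k : ℕ} (M : Matrix (Fin k) (Fin k) ℝ) (i : ℕ)
    (h : ‖M ^ (i + 1)‖ * ‖(1 : Matrix (Fin k) (Fin k) ℂ)‖ < 1) : specLt1 M := by
  unfold specLt1
  refine lt_of_le_of_lt (spectrum.spectralRadius_le_pow_nnnorm_pow_one_div ℂ _ i) ?_
  rw [← ENNReal.mul_rpow_of_nonneg _ _ (by positivity)]
  refine ENNReal.rpow_lt_one ?_ (by positivity)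
  rw [h_map_pow]
  have h2 : ‖(M ^ (i + 1)).map Complex.ofReal‖₊ * ‖(1 : Matrix (Fin k) (Fin k) ℂ)‖₊ < 1 := by
    rw [← NNReal.coe_lt_coe]
    push_cast
    rw [h_norm_map]
    exact h
  exact_mod_cast h2

theorem h_pow_bound {k : ℕ} (M : Matrix (Fin k) (Fin k) ℝ) (h : specLt1 M) :
    ∃ r : ℝ, 0 ≤ r ∧ r < 1 ∧ ∀ᶠ i : ℕ in atTop, ‖M ^ i‖ ≤ r ^ i := by
  unfold specLt1 at h
  obtain ⟨r, hr1, hr2⟩ := ENNReal.lt_iff_exists_nnreal_btwn.1 h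
  refine ⟨r, r.2, by exact_mod_cast hr2, ?_⟩
  have ht := spectrum.pow_nnnorm_pow_one_div_tendsto_nhds_spectralRadius (M.map Complex.ofReal)
  filter_upwards [ht.eventually (gt_mem_nhds hr1), eventually_gt_atTop 0] with i hi hi0
  rw [← h_norm_map, ← h_map_pow]
  have hi' : (0 : ℝ) < i := by exact_mod_cast hi0
  have h3 := ENNReal.rpow_le_rpow hi.le hi'.le
  rw [← ENNReal.rpow_mul, one_div, inv_mul_cancel₀ hi'.ne', ENNReal.rpow_one,
    ENNReal.rpow_natCast] at h3
  have h4 : ‖(M.map Complex.ofReal) ^ i‖₊ ≤ r ^ i := by exact_mod_cast h3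
  exact_mod_cast h4

theorem h_summable {k : ℕ} (M : Matrix (Fin k) (Fin k) ℝ) (h : specLt1 M) :
    Summable (fun i : ℕ => M ^ i * (Mᵀ) ^ i) := by
  obtain ⟨r, h0, h1, hb⟩ := h_pow_bound M h
  refine Summable.of_norm_bounded_eventually_nat (g := fun i => (r * r) ^ i)
    (summable_geometric_of_lt_one (by positivity) (by nlinarith)) ?_
  filter_upwards [hb] with i hi
  calc ‖M ^ i * (Mᵀ) ^ i‖ ≤ ‖M ^ i‖ * ‖(Mᵀ) ^ i‖ := Matrix.frobenius_norm_mul _ _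
    _ = ‖M ^ i‖ * ‖M ^ i‖ := by rw [← Matrix.transpose_pow, Matrix.frobenius_norm_transpose]
    _ ≤ r ^ i * r ^ i := by gcongr
    _ = (r * r) ^ i := by rw [mul_pow]

theorem h_tendsto {k : ℕ} (M : Matrix (Fin k) (Fin k) ℝ) (h : specLt1 M) :
    Tendsto (fun N : ℕ => ∑ i ∈ Finset.range N, M ^ i * (Mᵀ) ^ i) atTop (𝓝 (lyap M)) :=
  (h_summable M h).hasSum.tendsto_sum_nat

theorem h_sum_succ {k : ℕ} (M : Matrix (Fin k) (Fin k) ℝ) (N : ℕ) :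
    ∑ i ∈ Finset.range (N + 1), M ^ i * (Mᵀ) ^ i =
      1 + M * (∑ i ∈ Finset.range N, M ^ i * (Mᵀ) ^ i) * Mᵀ := by
  rw [Finset.sum_range_succ', Finset.mul_sum, Finset.sum_mul, add_comm]
  congr 1
  · simp
  · refine Finset.sum_congr rfl fun i _ => ?_
    rw [pow_succ', pow_succ]
    simp only [Matrix.mul_assoc]

theorem h_lyap_eq {k : ℕ} (M : Matrix (Fin k) (Fin k) ℝ) (h : specLt1 M) :
    lyap M = 1 + M * lyap M * Mᵀ := by
  have h1 := (h_tendsto M h).comp (tendsto_add_atTop_nat 1)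
  have h2 : Tendsto (fun N : ℕ => 1 + M * (∑ i ∈ Finset.range N, M ^ i * (Mᵀ) ^ i) * Mᵀ)
      atTop (𝓝 (1 + M * lyap M * Mᵀ)) :=
    (((h_tendsto M h).const_mul M).mul_const Mᵀ).const_add 1
  refine tendsto_nhds_unique h1 (h2.congr fun N => ?_)
  exact (h_sum_succ M N).symm

theorem h_psd_conj {ι κ : Type*} [Fintype ι] [Fintype κ] {S : Matrix ι ι ℝ} (hS : S.PosSemidef)
    (B : Matrix κ ι ℝ) : (B * S * Bᵀ).PosSemidef := by
  simpa using hS.mul_mul_conjTranspose_same B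

theorem h_psd_term {k : ℕ} (M : Matrix (Fin k) (Fin k) ℝ) (i : ℕ) :
    (M ^ i * (Mᵀ) ^ i).PosSemidef := by
  have := Matrix.posSemidef_self_mul_conjTranspose (M ^ i)
  simpa [Matrix.transpose_pow] using this

theorem h_psd_lim {k : ℕ} {F : ℕ → Matrix (Fin k) (Fin k) ℝ} {S : Matrix (Fin k) (Fin k) ℝ}
    (hF : ∀ i, (F i).PosSemidef) (h : Tendsto F atTop (𝓝 S)) : S.PosSemidef := by
  refine Matrix.PosSemidef.of_dotProduct_mulVec_nonneg ?_ fun x => ?_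
  · have h1 : Tendsto (fun i => (F i)ᴴ) atTop (𝓝 Sᴴ) :=
      (continuous_id.matrix_conjTranspose.tendsto S).comp h
    refine tendsto_nhds_unique (h1.congr fun i => ?_) h
    exact (hF i).1
  · have hc : Continuous fun T : Matrix (Fin k) (Fin k) ℝ => star x ⬝ᵥ (T *ᵥ x) := by fun_prop
    exact ge_of_tendsto' ((hc.tendsto S).comp h) fun i => (hF i).dotProduct_mulVec_nonneg x

theorem h_lyap_psd {k : ℕ} (M : Matrix (Fin k) (Fin k) ℝ) (h : specLt1 M) :
    (lyap M).PosSemidef :=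
  h_psd_lim (fun _ => Matrix.posSemidef_sum _ fun i _ => h_psd_term M i) (h_tendsto M h)

theorem h_psd_factor {k : ℕ} {S : Matrix (Fin k) (Fin k) ℝ} (h : S.PosSemidef) :
    ∃ C : Matrix (Fin k) (Fin k) ℝ, S = C * Cᵀ := by
  open scoped MatrixOrder in
  obtain ⟨C, hC⟩ := CStarAlgebra.nonneg_iff_eq_star_mul_self.mp h.nonneg
  refine ⟨Cᵀ, ?_⟩
  rw [hC]
  simp [Matrix.star_eq_conjTranspose]

theorem h_norm_sq {ι κ : Type*} [Fintype ι] [Fintype κ] (C : Matrix ι κ ℝ) :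
    ‖C‖ ^ 2 = ∑ i, ∑ j, C i j ^ 2 := by
  rw [Matrix.frobenius_norm_def, ← Real.sqrt_eq_rpow, Real.sq_sqrt (by positivity)]
  simp

theorem h_norm_sq_trace {ι κ : Type*} [Fintype ι] [Fintype κ] (C : Matrix ι κ ℝ) :
    ‖C‖ ^ 2 = (C * Cᵀ).trace := by
  rw [h_norm_sq]
  simp [Matrix.trace, Matrix.mul_apply, sq]

theorem h_norm_le_trace {k : ℕ} {S : Matrix (Fin k) (Fin k) ℝ} (h : S.PosSemidef) :
    ‖S‖ ≤ S.trace := by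
  obtain ⟨C, rfl⟩ := h_psd_factor h
  refine (Matrix.frobenius_norm_mul _ _).trans ?_
  rw [Matrix.frobenius_norm_transpose, ← h_norm_sq_trace, sq]

theorem h_trace_mul_nonneg {k : ℕ} {P S : Matrix (Fin k) (Fin k) ℝ} (hP : P.PosSemidef)
    (hS : S.PosSemidef) : 0 ≤ (P * S).trace := by
  obtain ⟨C, rfl⟩ := h_psd_factor hS
  rw [← Matrix.mul_assoc, Matrix.trace_mul_comm, ← Matrix.mul_assoc]
  simpa using (h_psd_conj hP Cᵀ).trace_nonneg

theorem h_quad_le {k : ℕ} (N : Matrix (Fin k) (Fin k) ℝ) (x : Fin k → ℝ) :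
    x ⬝ᵥ (N *ᵥ x) ≤ ‖N‖ * (x ⬝ᵥ x) := by
  have h1 : (x ⬝ᵥ (N *ᵥ x)) = (replicateRow Unit x * N * replicateCol Unit x) () () := by
    rw [Matrix.mul_assoc, ← Matrix.replicateCol_mulVec]
    simp [Matrix.mul_apply, dotProduct]
  have h2 : ‖replicateRow Unit x‖ ^ 2 = x ⬝ᵥ x := by
    rw [h_norm_sq]; simp [dotProduct, sq]
  have h3 : ‖replicateCol Unit x‖ = ‖replicateRow Unit x‖ := by
    rw [← Matrix.frobenius_norm_transpose, Matrix.transpose_replicateCol]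
  have h4 : ∀ T : Matrix Unit Unit ℝ, T () () ≤ ‖T‖ := by
    intro T
    refine (le_abs_self _).trans (abs_le_of_sq_le_sq ?_ (norm_nonneg _))
    rw [h_norm_sq]; simp
  rw [h1]
  calc _ ≤ ‖replicateRow Unit x * N * replicateCol Unit x‖ := h4 _
    _ ≤ ‖replicateRow Unit x‖ * ‖N‖ * ‖replicateCol Unit x‖ :=
      (Matrix.frobenius_norm_mul _ _).trans
        (mul_le_mul_of_nonneg_right (Matrix.frobenius_norm_mul _ _) (norm_nonneg _))
    _ = ‖N‖ * (x ⬝ᵥ x) := by rw [h3, ← h2]; ring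

/-- `N ≤ ‖N‖ I`. -/
theorem h_psd_norm {k : ℕ} {N : Matrix (Fin k) (Fin k) ℝ} (hN : N.IsHermitian) (c : ℝ)
    (hc : ‖N‖ ≤ c) : (c • (1 : Matrix (Fin k) (Fin k) ℝ) - N).PosSemidef := by
  refine Matrix.PosSemidef.of_dotProduct_mulVec_nonneg ?_ fun x => ?_
  · exact (Matrix.isHermitian_one.smul (IsSelfAdjoint.all c)).sub hN
  · have h := h_quad_le N x
    have h0 : 0 ≤ x ⬝ᵥ x := by
      simp only [dotProduct]; exact Finset.sum_nonneg fun i _ => mul_self_nonneg _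
    rw [Matrix.sub_mulVec, Matrix.smul_mulVec, Matrix.one_mulVec, dotProduct_sub]
    simp only [star_trivial, dotProduct_smul, smul_eq_mul]
    nlinarith

/-- Lyapunov certificate. -/
theorem h_cert {k : ℕ} {M S : Matrix (Fin k) (Fin k) ℝ} (hS : S.PosSemidef) {c : ℝ} (hc : 0 < c)
    (h : (S - c • (1 : Matrix (Fin k) (Fin k) ℝ) - M * S * Mᵀ).PosSemidef) :
    specLt1 M ∧ ∀ P : Matrix (Fin k) (Fin k) ℝ, P.PosSemidef →
      c * (P * lyap M).trace ≤ (P * S).trace := by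
  have hind : ∀ N : ℕ, (S - c • (∑ i ∈ Finset.range N, M ^ i * (Mᵀ) ^ i)
      - M ^ N * S * (M ^ N)ᵀ).PosSemidef := by
    intro N
    induction N with
    | zero => simpa using Matrix.PosSemidef.zero
    | succ N ih =>
      have h1 := ih.add (h_psd_conj h (M ^ N))
      convert h1 using 1
      rw [Finset.sum_range_succ, pow_succ M N, Matrix.transpose_mul, Matrix.transpose_pow]
      simp only [Matrix.mul_sub, Matrix.sub_mul, smul_add, Matrix.mul_assoc, Matrix.mul_smul,
        Matrix.smul_mul, Matrix.mul_one]
      abel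
  have hind2 : ∀ N : ℕ, (S - c • (∑ i ∈ Finset.range N, M ^ i * (Mᵀ) ^ i)).PosSemidef := by
    intro N
    have := (hind N).add (h_psd_conj hS (M ^ N))
    simpa using this
  have hsum : Summable (fun i : ℕ => ‖M ^ i‖ ^ 2) := by
    refine summable_of_sum_range_le (c := S.trace / c) (fun i => by positivity) fun N => ?_
    have h1 := (hind2 N).trace_nonneg
    rw [Matrix.trace_sub, Matrix.trace_smul, Matrix.trace_sum] at h1
    rw [le_div_iff₀ hc, mul_comm]
    have h2 : ∀ i, ‖M ^ i‖ ^ 2 = (M ^ i * (Mᵀ) ^ i).trace := fun i => by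
      rw [h_norm_sq_trace, Matrix.transpose_pow]
    simp only [h2]
    simp only [smul_eq_mul] at h1
    linarith
  have hspec : specLt1 M := by
    have ht := hsum.tendsto_atTop_zero
    have ht2 : Tendsto (fun i : ℕ => ‖M ^ i‖ * ‖(1 : Matrix (Fin k) (Fin k) ℂ)‖) atTop (𝓝 0) := by
      have h3 := ht.sqrt
      simp only [Real.sqrt_sq (norm_nonneg _), Real.sqrt_zero] at h3
      simpa using h3.mul_const ‖(1 : Matrix (Fin k) (Fin k) ℂ)‖
    obtain ⟨i, hi, hi0⟩ := ((ht2.eventually (gt_mem_nhds one_pos)).and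
      (eventually_gt_atTop 0)).exists
    obtain ⟨j, rfl⟩ := Nat.exists_eq_succ_of_ne_zero hi0.ne'
    exact h_specLt1_of_pow M j hi
  refine ⟨hspec, fun P hP => ?_⟩
  have hl : (S - c • lyap M).PosSemidef :=
    h_psd_lim hind2 (((h_tendsto M hspec).const_smul c).const_sub S)
  have := h_trace_mul_nonneg hP hl
  rw [Matrix.mul_sub, Matrix.mul_smul, Matrix.trace_sub, Matrix.trace_smul, smul_eq_mul] at this
  linarith

theorem h_posDef_lower {k : ℕ} {Q : Matrix (Fin k) (Fin k) ℝ} (hQ : Q.PosDef) :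
    ∃ q : ℝ, 0 < q ∧ (Q - q • (1 : Matrix (Fin k) (Fin k) ℝ)).PosSemidef := by
  obtain ⟨C, hC⟩ := h_psd_factor hQ.posSemidef
  have hdet : IsUnit C.det := by
    have h1 : Q.det ≠ 0 := hQ.det_pos.ne'
    rw [hC, Matrix.det_mul] at h1
    exact (left_ne_zero_of_mul h1).isUnit
  have hCi : C * C⁻¹ = 1 := Matrix.mul_nonsing_inv _ hdet
  have hT : (C⁻¹ * C⁻¹ᵀ).IsHermitian := by
    have := (Matrix.posSemidef_self_mul_conjTranspose C⁻¹).1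
    simpa using this
  set c : ℝ := ‖C⁻¹ * C⁻¹ᵀ‖ + 1 with hc
  have hc0 : 0 < c := by positivity
  have h1 := h_psd_conj (h_psd_norm hT c (by rw [hc]; linarith)) C
  have h2 : C * (c • (1 : Matrix (Fin k) (Fin k) ℝ) - C⁻¹ * C⁻¹ᵀ) * Cᵀ = c • Q - 1 := by
    have h3 : C⁻¹ᵀ * Cᵀ = 1 := by rw [← Matrix.transpose_mul, hCi, Matrix.transpose_one]
    rw [Matrix.mul_sub, Matrix.sub_mul, hC, ← Matrix.mul_assoc C, hCi, Matrix.one_mul, h3]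
    simp
  rw [h2] at h1
  refine ⟨c⁻¹, by positivity, ?_⟩
  have h4 := h1.smul (inv_nonneg.2 hc0.le)
  rwa [smul_sub, smul_smul, inv_mul_cancel₀ hc0.ne', one_smul] at h4

/-- LQR cost of the gain `K` for the system `(A, B)`. -/
def hCost {n m : ℕ} (Q : Matrix (Fin n) (Fin n) ℝ) (R : Matrix (Fin m) (Fin m) ℝ)
    (A : Matrix (Fin n) (Fin n) ℝ) (B : Matrix (Fin n) (Fin m) ℝ)
    (K : Matrix (Fin m) (Fin n) ℝ) : ℝ :=
  Matrix.trace ((Q + Kᵀ * R * K) * lyap (A + B * K))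

theorem h_QK_psd {n m : ℕ} {Q : Matrix (Fin n) (Fin n) ℝ} {R : Matrix (Fin m) (Fin m) ℝ}
    (hQ : Q.PosDef) (hR : R.PosDef) (K : Matrix (Fin m) (Fin n) ℝ) :
    (Q + Kᵀ * R * K).PosSemidef :=
  hQ.posSemidef.add (by simpa using h_psd_conj hR.posSemidef Kᵀ)

theorem hCost_nonneg {n m : ℕ} {Q : Matrix (Fin n) (Fin n) ℝ} {R : Matrix (Fin m) (Fin m) ℝ}
    (hQ : Q.PosDef) (hR : R.PosDef) (A : Matrix (Fin n) (Fin n) ℝ) (B : Matrix (Fin n) (Fin m) ℝ)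
    (K : Matrix (Fin m) (Fin n) ℝ) (h : specLt1 (A + B * K)) : 0 ≤ hCost Q R A B K :=
  h_trace_mul_nonneg (h_QK_psd hQ hR K) (h_lyap_psd _ h)

theorem h_le_one_add {x s : ℝ} (h : x ^ 2 ≤ s) : x ≤ 1 + s := by
  nlinarith [sq_nonneg (x - 1)]

theorem h_bounds {n m : ℕ} {Q : Matrix (Fin n) (Fin n) ℝ} {R : Matrix (Fin m) (Fin m) ℝ}
    (hR : R.PosDef) {q r : ℝ} (hq : 0 < q) (hr : 0 < r)
    (hQq : (Q - q • (1 : Matrix (Fin n) (Fin n) ℝ)).PosSemidef)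
    (hRr : (R - r • (1 : Matrix (Fin m) (Fin m) ℝ)).PosSemidef)
    (K : Matrix (Fin m) (Fin n) ℝ) {M S : Matrix (Fin n) (Fin n) ℝ} (hS : S.PosSemidef)
    (hM : S = 1 + M * S * Mᵀ) {a : ℝ} (ha : ((Q + Kᵀ * R * K) * S).trace ≤ a) :
    ‖S‖ ≤ a / q ∧ ‖K‖ ≤ 1 + a / r ∧ ‖M‖ ≤ 1 + a / q := by
  have hS1 : (S - 1).PosSemidef := by
    have : S - 1 = M * S * Mᵀ := by rw [sub_eq_iff_eq_add']; exact hM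
    rw [this]; exact h_psd_conj hS M
  have hKRK : (Kᵀ * R * K).PosSemidef := by simpa using h_psd_conj hR.posSemidef Kᵀ
  have e1 := h_trace_mul_nonneg hQq hS
  have e2 := h_trace_mul_nonneg hKRK hS1
  have e3 := h_trace_mul_nonneg hKRK hS
  have e4 := (h_psd_conj hRr Kᵀ).trace_nonneg
  have e5 := (h_psd_conj hS1 M).trace_nonneg
  have e6 := h_norm_sq_trace M
  have e7 := h_norm_sq_trace Kᵀ
  have e8 := h_norm_le_trace hS
  have e9 : (M * S * Mᵀ).trace ≤ S.trace := by
    have h1 : S.trace = (1 + M * S * Mᵀ).trace := by rw [← hM]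
    have h2 : (0 : ℝ) ≤ (1 : Matrix (Fin n) (Fin n) ℝ).trace := Matrix.PosSemidef.one.trace_nonneg
    rw [h1, Matrix.trace_add]; linarith
  rw [Matrix.frobenius_norm_transpose] at e7
  simp only [Matrix.mul_sub, Matrix.sub_mul, Matrix.add_mul, Matrix.trace_sub, Matrix.trace_add,
    Matrix.mul_smul, Matrix.smul_mul, Matrix.trace_smul, Matrix.mul_one, Matrix.one_mul,
    smul_eq_mul, Matrix.transpose_transpose] at *
  have hS0 := hS.trace_nonneg
  have hS2 : S.trace ≤ a / q := by
    rw [le_div_iff₀ hq]; nlinarith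
  have hqs : 0 ≤ q * S.trace := by positivity
  refine ⟨e8.trans hS2, h_le_one_add ?_, h_le_one_add ?_⟩
  · rw [le_div_iff₀ hr, mul_comm]; nlinarith
  · linarith

theorem h_perturb {n m : ℕ} {Q : Matrix (Fin n) (Fin n) ℝ} {R : Matrix (Fin m) (Fin m) ℝ}
    (hQ : Q.PosDef) (hR : R.PosDef) (a : ℝ) (ha : 0 ≤ a) :
    ∃ e0 > (0 : ℝ), ∃ c > (0 : ℝ), ∀ (A A' : Matrix (Fin n) (Fin n) ℝ)
      (B B' : Matrix (Fin n) (Fin m) ℝ) (K : Matrix (Fin m) (Fin n) ℝ) (e : ℝ), 0 ≤ e → e ≤ e0 →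
      ‖A' - A‖ ≤ e → ‖B' - B‖ ≤ e → specLt1 (A + B * K) → hCost Q R A B K ≤ a →
      specLt1 (A' + B' * K) ∧ hCost Q R A' B' K ≤ hCost Q R A B K + c * e := by
  obtain ⟨q, hq, hQq⟩ := h_posDef_lower hQ
  obtain ⟨r, hr, hRr⟩ := h_posDef_lower hR
  set s : ℝ := a / q with hs
  have hs0 : 0 ≤ s := by positivity
  set κ : ℝ := 1 + a / r with hκ
  have hκ0 : 0 ≤ κ := by positivity
  set L : ℝ := 1 + κ with hL
  have hL0 : 0 < L := by positivity
  set H : ℝ := (2 * (1 + s) * s + s) * L + 1 with hH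
  have hH0 : 0 < H := by positivity
  refine ⟨1 / (2 * H + L), by positivity, 2 * H * a + 1, by positivity, ?_⟩
  intro A A' B B' K e he0 he hA hB hspec hcost
  set M := A + B * K with hM
  set S := lyap M with hSdef
  have hS : S.PosSemidef := h_lyap_psd M hspec
  have hSeq : S = 1 + M * S * Mᵀ := h_lyap_eq M hspec
  obtain ⟨b1, b2, b3⟩ := h_bounds hR hq hr hQq hRr K hS hSeq (a := a) hcost
  set D := (A' - A) + (B' - B) * K with hD
  have hM' : A' + B' * K = M + D := by rw [hM, hD, Matrix.sub_mul]; abel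
  have hDn : ‖D‖ ≤ e * L := by
    calc ‖D‖ ≤ ‖A' - A‖ + ‖(B' - B) * K‖ := norm_add_le _ _
      _ ≤ e + e * κ := by
        refine add_le_add hA ((Matrix.frobenius_norm_mul _ _).trans ?_)
        gcongr
      _ = e * L := by rw [hL]; ring
  have he1 : e * (2 * H + L) ≤ 1 := by rwa [le_div_iff₀ (by positivity)] at he
  have heL : e * L ≤ 1 := by nlinarith [mul_nonneg he0 hH0.le]
  have heH : H * e ≤ 1 / 2 := by nlinarith [mul_nonneg he0 hL0.le]
  set N := M * S * Dᵀ + D * S * Mᵀ + D * S * Dᵀ with hN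
  have hST : Sᵀ = S := by
    have := hS.1
    rwa [Matrix.IsHermitian, Matrix.conjTranspose_eq_transpose_of_trivial] at this
  have hNh : N.IsHermitian := by
    rw [Matrix.IsHermitian, Matrix.conjTranspose_eq_transpose_of_trivial, hN]
    simp only [Matrix.transpose_add, Matrix.transpose_mul, Matrix.transpose_transpose, hST,
      Matrix.mul_assoc]
    abel
  have n3 : ∀ X Y : Matrix (Fin n) (Fin n) ℝ, ‖X * S * Yᵀ‖ ≤ ‖X‖ * ‖S‖ * ‖Y‖ := by
    intro X Y
    refine (Matrix.frobenius_norm_mul _ _).trans ?_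
    rw [Matrix.frobenius_norm_transpose]
    exact mul_le_mul_of_nonneg_right (Matrix.frobenius_norm_mul _ _) (norm_nonneg _)
  have hNn : ‖N‖ ≤ H * e := by
    have t1 : ‖M * S * Dᵀ‖ ≤ (1 + s) * s * (e * L) := (n3 M D).trans (by gcongr)
    have t2 : ‖D * S * Mᵀ‖ ≤ (e * L) * s * (1 + s) := (n3 D M).trans (by gcongr)
    have t3 : ‖D * S * Dᵀ‖ ≤ (e * L) * s * 1 := (n3 D D).trans (by
      have := hDn.trans heL
      gcongr)
    have t4 : ‖N‖ ≤ ‖M * S * Dᵀ‖ + ‖D * S * Mᵀ‖ + ‖D * S * Dᵀ‖ := norm_add₃_le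
    have : H * e = (1 + s) * s * (e * L) + (e * L) * s * (1 + s) + (e * L) * s * 1 + e := by
      rw [hH]; ring
    linarith
  have hpsd := h_psd_norm hNh (H * e) hNn
  have hcert : (S - (1 - H * e) • (1 : Matrix (Fin n) (Fin n) ℝ)
      - (M + D) * S * (M + D)ᵀ).PosSemidef := by
    convert hpsd using 1
    rw [sub_smul, one_smul]
    nth_rewrite 1 [hSeq]
    rw [hN]
    simp only [Matrix.transpose_add, Matrix.mul_add, Matrix.add_mul]
    abel
  obtain ⟨c1, c2⟩ := h_cert hS (by linarith : 0 < 1 - H * e) hcert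
  rw [← hM'] at c1 c2
  refine ⟨c1, ?_⟩
  have hf := c2 _ (h_QK_psd hQ hR K)
  change (1 - H * e) * hCost Q R A' B' K ≤ hCost Q R A B K at hf
  have hf0 := hCost_nonneg hQ hR A' B' K c1
  have hf1 : hCost Q R A' B' K ≤ 2 * a := by nlinarith
  nlinarith [mul_le_mul_of_nonneg_left hf1 (mul_nonneg hH0.le he0)]

/-- States that can be steered to zero in `k` steps. -/
def hV {E F : Type*} [AddCommGroup E] [Module ℝ E] [AddCommGroup F] [Module ℝ F]
    (a : E →ₗ[ℝ] E) (b : F →ₗ[ℝ] E) : ℕ → Submodule ℝ E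
  | 0 => ⊥
  | k + 1 => ((hV a b k).comap (a.coprod b)).map (LinearMap.fst ℝ E F)

theorem hV_succ {E F : Type*} [AddCommGroup E] [Module ℝ E] [AddCommGroup F] [Module ℝ F]
    (a : E →ₗ[ℝ] E) (b : F →ₗ[ℝ] E) (k : ℕ) (x : E) :
    x ∈ hV a b (k + 1) ↔ ∃ u, a x + b u ∈ hV a b k := by
  simp [hV]

theorem hV_mono {E F : Type*} [AddCommGroup E] [Module ℝ E] [AddCommGroup F] [Module ℝ F]
    (a : E →ₗ[ℝ] E) (b : F →ₗ[ℝ] E) (k : ℕ) : hV a b k ≤ hV a b (k + 1) := by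
  induction k with
  | zero => exact bot_le
  | succ k ih =>
    intro x hx
    rw [hV_succ] at hx ⊢
    obtain ⟨u, hu⟩ := hx
    exact ⟨u, ih hu⟩

theorem hV_feedback {E F : Type*} [AddCommGroup E] [Module ℝ E] [AddCommGroup F] [Module ℝ F]
    (a : E →ₗ[ℝ] E) (b : F →ₗ[ℝ] E) (k : ℕ) :
    ∃ f : E →ₗ[ℝ] F, ∀ x ∈ hV a b (k + 1), a x + b (f x) ∈ hV a b k := by
  let G : Submodule ℝ (E × F) := (hV a b k).comap (a.coprod b)
  let p : G →ₗ[ℝ] hV a b (k + 1) :=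
    ((LinearMap.fst ℝ E F).comp G.subtype).codRestrict _ fun g =>
      (hV_succ a b k _).2 ⟨g.1.2, g.2⟩
  have hp : LinearMap.range p = ⊤ := by
    rw [LinearMap.range_eq_top]
    rintro ⟨x, hx⟩
    obtain ⟨u, hu⟩ := (hV_succ a b k x).1 hx
    exact ⟨⟨(x, u), by simpa [G] using hu⟩, by ext; simp [p]⟩
  obtain ⟨g, hg⟩ := p.exists_rightInverse_of_surjective hp
  obtain ⟨f, hf⟩ := LinearMap.exists_extend (((LinearMap.snd ℝ E F).comp G.subtype).comp g)
  refine ⟨f, fun x hx => ?_⟩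
  have h1 : f x = (g ⟨x, hx⟩).1.2 := by
    have := LinearMap.congr_fun hf ⟨x, hx⟩
    simpa using this
  have h2 : (g ⟨x, hx⟩).1.1 = x := by
    have := LinearMap.congr_fun hg ⟨x, hx⟩
    simpa [p] using congrArg Subtype.val this
  have h3 : a (g ⟨x, hx⟩).1.1 + b (g ⟨x, hx⟩).1.2 ∈ hV a b k :=
    (g ⟨x, hx⟩).2
  rwa [h2, ← h1] at h3

theorem hV_feedback_all {E F : Type*} [AddCommGroup E] [Module ℝ E] [AddCommGroup F] [Module ℝ F]
    (a : E →ₗ[ℝ] E) (b : F →ₗ[ℝ] E) (k : ℕ) :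
    ∃ f : E →ₗ[ℝ] F, ∀ j < k, ∀ x ∈ hV a b (j + 1), a x + b (f x) ∈ hV a b j := by
  induction k with
  | zero => exact ⟨0, fun j hj => absurd hj (Nat.not_lt_zero j)⟩
  | succ k ih =>
    obtain ⟨f, hf⟩ := ih
    obtain ⟨g, hg⟩ := hV_feedback a b k
    obtain ⟨π, hπ⟩ := LinearMap.exists_extend (LinearMap.id (R := ℝ) (M := hV a b k))
    have hπ' : ∀ x ∈ hV a b k, (π x : E) = x := by
      intro x hx
      have := LinearMap.congr_fun hπ ⟨x, hx⟩
      simpa using congrArg Subtype.val this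
    let P : E →ₗ[ℝ] E := (hV a b k).subtype.comp π
    have hmono : Monotone (hV a b) := monotone_nat_of_le_succ (hV_mono a b)
    refine ⟨f.comp P + g.comp (LinearMap.id - P), fun j hj x hx => ?_⟩
    rcases Nat.lt_succ_iff_lt_or_eq.1 hj with hj | rfl
    · have hx2 : P x = x := hπ' x (hmono hj hx)
      simpa [hx2] using hf j hj x hx
    · have hPx : P x ∈ hV a b j := (π x).2
      have h1 : a (P x) + b (f (P x)) ∈ hV a b j := by
        cases j with
        | zero =>
          have : P x = 0 := hPx
          simp [this]
        | succ i => exact hV_mono a b i (hf i (Nat.lt_succ_self i) _ hPx)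
      have h2 := hg (x - P x) (Submodule.sub_mem _ hx (hV_mono a b j hPx))
      have h3 := Submodule.add_mem _ h1 h2
      convert h3 using 1
      simp only [LinearMap.add_apply, LinearMap.comp_apply, LinearMap.sub_apply,
        LinearMap.id_apply, map_add, map_sub]
      abel

theorem hV_reach {E F : Type*} [AddCommGroup E] [Module ℝ E] [AddCommGroup F] [Module ℝ F]
    (a : E →ₗ[ℝ] E) (b : F →ₗ[ℝ] E) (k : ℕ) (x : E) (u : ℕ → F)
    (h : (a ^ k) x + ∑ i ∈ Finset.range k, (a ^ i) (b (u i)) = 0) : x ∈ hV a b k := by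
  induction k generalizing x with
  | zero =>
    have : x = 0 := by simpa using h
    rw [this]; exact Submodule.zero_mem _
  | succ k ih =>
    rw [hV_succ]
    refine ⟨u k, ih _ ?_⟩
    rw [Finset.sum_range_succ, pow_succ, Module.End.mul_apply] at h
    rw [map_add, ← h]
    abel

theorem h_deadbeat {n m : ℕ} (hn : 0 < n)
    (A : Matrix (Fin n) (Fin n) ℝ) (B : Matrix (Fin n) (Fin m) ℝ)
    (hctrb : (Matrix.of fun (i : Fin n) (p : Fin n × Fin m) =>
        (A ^ (p.1 : ℕ) * B) i p.2).rank = n) :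
    ∃ K : Matrix (Fin m) (Fin n) ℝ, specLt1 (A + B * K) := by
  set C := (Matrix.of fun (i : Fin n) (p : Fin n × Fin m) => (A ^ (p.1 : ℕ) * B) i p.2) with hC
  have hsurj : Function.Surjective C.mulVecLin := by
    rw [← LinearMap.range_eq_top]
    apply Submodule.eq_top_of_finrank_eq
    rw [← Matrix.rank, hctrb]; simp
  have htop : ∀ x, x ∈ hV A.mulVecLin B.mulVecLin n := by
    intro x
    obtain ⟨w, hw⟩ := hsurj (-((A ^ n) *ᵥ x))
    refine hV_reach _ _ n x (fun i => if h : i < n then fun j => w (⟨i, h⟩, j) else 0) ?_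
    have hp : ∀ (i : ℕ) (y : Fin n → ℝ), (A.mulVecLin ^ i) y = (A ^ i) *ᵥ y := by
      intro i y
      induction i with
      | zero => simp
      | succ i ih => rw [pow_succ', Module.End.mul_apply, ih, pow_succ']; simp
    rw [Finset.sum_range]
    simp only [hp, Matrix.mulVecLin_apply, Matrix.mulVec_mulVec, Fin.is_lt, dif_pos, Fin.eta]
    rw [Matrix.mulVecLin_apply] at hw
    rw [add_comm, ← eq_neg_iff_add_eq_zero, ← hw]
    ext i
    rw [Finset.sum_apply]
    simp only [hC, Matrix.mulVec, dotProduct, Fintype.sum_prod_type, Matrix.of_apply]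
  obtain ⟨f, hf⟩ := hV_feedback_all A.mulVecLin B.mulVecLin n
  refine ⟨LinearMap.toMatrix' f, ?_⟩
  set K := LinearMap.toMatrix' f with hK
  have hKf : ∀ x, K *ᵥ x = f x := by intro x; rw [hK, LinearMap.toMatrix'_mulVec]
  have hnil : ∀ j ≤ n, ∀ x ∈ hV A.mulVecLin B.mulVecLin j, ((A + B * K) ^ j) *ᵥ x = 0 := by
    intro j
    induction j with
    | zero => 
      intro _ x hx
      have : x = 0 := hx
      simp [this]
    | succ j ih =>
      intro hj x hx
      rw [pow_succ, ← Matrix.mulVec_mulVec]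
      refine ih (by omega) _ ?_
      have := hf j (by omega) x hx
      rw [Matrix.add_mulVec, ← Matrix.mulVec_mulVec, hKf]
      simpa using this
  have hzero : (A + B * K) ^ n = 0 := by
    apply Matrix.ext_of_mulVec_single
    intro i
    rw [hnil n le_rfl _ (htop _), Matrix.zero_mulVec]
  obtain ⟨k, rfl⟩ := Nat.exists_eq_succ_of_ne_zero hn.ne'
  refine h_specLt1_of_pow _ k ?_
  rw [hzero]; simp

/-- Optimal value of the LQR problem of the system `(A, B)`. -/
def hOpt {n m : ℕ} (Q : Matrix (Fin n) (Fin n) ℝ) (R : Matrix (Fin m) (Fin m) ℝ)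
    (A : Matrix (Fin n) (Fin n) ℝ) (B : Matrix (Fin n) (Fin m) ℝ) : ℝ :=
  sInf (hCost Q R A B '' {K | specLt1 (A + B * K)})

theorem hOpt_le {n m : ℕ} {Q : Matrix (Fin n) (Fin n) ℝ} {R : Matrix (Fin m) (Fin m) ℝ}
    (hQ : Q.PosDef) (hR : R.PosDef) (A : Matrix (Fin n) (Fin n) ℝ) (B : Matrix (Fin n) (Fin m) ℝ)
    (K : Matrix (Fin m) (Fin n) ℝ) (h : specLt1 (A + B * K)) :
    hOpt Q R A B ≤ hCost Q R A B K := by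
  refine csInf_le ⟨0, ?_⟩ ⟨K, h, rfl⟩
  rintro _ ⟨K', hK', rfl⟩
  exact hCost_nonneg hQ hR A B K' hK'

theorem h_gap {n m : ℕ} (hn : 0 < n)
    (A : Matrix (Fin n) (Fin n) ℝ) (B : Matrix (Fin n) (Fin m) ℝ)
    {Q : Matrix (Fin n) (Fin n) ℝ} {R : Matrix (Fin m) (Fin m) ℝ}
    (hQ : Q.PosDef) (hR : R.PosDef)
    (hctrb : (Matrix.of fun (i : Fin n) (p : Fin n × Fin m) =>
        (A ^ (p.1 : ℕ) * B) i p.2).rank = n) :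
    ∃ e0 > (0 : ℝ), ∃ c > (0 : ℝ), ∀ (A' : Matrix (Fin n) (Fin n) ℝ)
      (B' : Matrix (Fin n) (Fin m) ℝ) (e : ℝ), 0 ≤ e → e ≤ e0 →
      ‖A' - A‖ ≤ e → ‖B' - B‖ ≤ e →
      (∃ K : Matrix (Fin m) (Fin n) ℝ, specLt1 (A' + B' * K)) ∧
      |hOpt Q R A' B' - hOpt Q R A B| ≤ c * e := by
  obtain ⟨K0, hK0⟩ := h_deadbeat hn A B hctrb
  have hf0 := hCost_nonneg hQ hR A B K0 hK0
  obtain ⟨e0, he0, c, hc, hp⟩ := h_perturb hQ hR (hCost Q R A B K0 + 1) (by linarith)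
  refine ⟨e0, he0, c, hc, fun A' B' e h0 he hA hB => ?_⟩
  have hA' : ‖A - A'‖ ≤ e := by rwa [norm_sub_rev]
  have hB' : ‖B - B'‖ ≤ e := by rwa [norm_sub_rev]
  have hce : 0 ≤ c * e := by positivity
  obtain ⟨k1, k2⟩ := hp A A' B B' K0 e h0 he hA hB hK0 (by linarith)
  refine ⟨⟨K0, k1⟩, ?_⟩
  have u1 : hOpt Q R A' B' - c * e ≤ hOpt Q R A B := by
    refine le_csInf ⟨_, K0, hK0, rfl⟩ ?_
    rintro _ ⟨K, hK, rfl⟩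
    have hK : specLt1 (A + B * K) := hK
    by_cases hle : hCost Q R A B K ≤ hCost Q R A B K0 + 1
    · obtain ⟨l1, l2⟩ := hp A A' B B' K e h0 he hA hB hK hle
      have := hOpt_le hQ hR A' B' K l1
      linarith
    · have := hOpt_le hQ hR A' B' K0 k1
      linarith
  have u2 : hOpt Q R A B - c * e ≤ hOpt Q R A' B' := by
    refine le_csInf ⟨_, K0, k1, rfl⟩ ?_
    rintro _ ⟨K, hK, rfl⟩
    have hK : specLt1 (A' + B' * K) := hK
    by_cases hle : hCost Q R A' B' K ≤ hCost Q R A B K0 + 1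
    · obtain ⟨l1, l2⟩ := hp A' A B' B K e h0 he hA' hB' hK hle
      have := hOpt_le hQ hR A B K l1
      linarith
    · have := hOpt_le hQ hR A B K0 hK0
      linarith
  rw [abs_le]
  constructor <;> linarith

theorem h_eNorm_sq {ι : Type*} [Fintype ι] (v : ι → ℝ) : eNorm v ^ 2 = ∑ i, v i ^ 2 := by
  rw [eNorm, Real.sq_sqrt (by positivity)]

theorem h_eNorm_smul {ι : Type*} [Fintype ι] (c : ℝ) (hc : 0 ≤ c) (v : ι → ℝ) :
    eNorm (c • v) = c * eNorm v := by
  simp only [eNorm, Pi.smul_apply, smul_eq_mul, mul_pow, ← Finset.mul_sum]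
  rw [Real.sqrt_mul (by positivity), Real.sqrt_sq hc]

theorem h_sigMin {ι κ : Type*} [Fintype ι] [Fintype κ] (D : Matrix ι κ ℝ) (s : ℝ)
    (hs : s ≤ sigMin D) (u : ι → ℝ) : s * eNorm u ≤ eNorm (D.vecMul u) := by
  have hu0 : 0 ≤ eNorm u := Real.sqrt_nonneg _
  rcases hu0.eq_or_lt with h | h
  · rw [← h]; simp [eNorm]
  · have h1 : eNorm ((eNorm u)⁻¹ • u) = 1 := by
      rw [h_eNorm_smul _ (by positivity), inv_mul_cancel₀ h.ne']
    have h2 : sigMin D ≤ eNorm (D.vecMul ((eNorm u)⁻¹ • u)) :=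
      csInf_le ⟨0, by rintro _ ⟨v, _, rfl⟩; exact Real.sqrt_nonneg _⟩ ⟨_, h1, rfl⟩
    rw [Matrix.smul_vecMul, h_eNorm_smul _ (by positivity)] at h2
    have h3 := hs.trans h2
    rwa [← div_eq_inv_mul, le_div_iff₀ h] at h3

theorem h_data {n t : ℕ} {ι : Type*} [Fintype ι] [DecidableEq ι] (D : Matrix ι (Fin t) ℝ)
    (W : Matrix (Fin n) (Fin t) ℝ) (s δ : ℝ) (hs0 : 0 < s) (hδ : 0 ≤ δ) (hs : s ≤ sigMin D)
    (hW : ∀ j, eNorm (fun i => W i j) ≤ δ) (hD : IsUnit (D * Dᵀ).det) :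
    ∃ E : Matrix (Fin n) ι ℝ, E * (D * Dᵀ) = W * Dᵀ ∧ s * ‖E‖ ≤ Real.sqrt t * δ := by
  refine ⟨W * Dᵀ * (D * Dᵀ)⁻¹, ?_, ?_⟩
  · rw [Matrix.mul_assoc, Matrix.nonsing_inv_mul _ hD, Matrix.mul_one]
  · have hE : (W * Dᵀ * (D * Dᵀ)⁻¹) * (D * Dᵀ) = W * Dᵀ := by
      rw [Matrix.mul_assoc, Matrix.nonsing_inv_mul _ hD, Matrix.mul_one]
    set E := W * Dᵀ * (D * Dᵀ)⁻¹
    have h1 : s ^ 2 * ‖E‖ ^ 2 ≤ ‖E * D‖ ^ 2 := by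
      rw [h_norm_sq, h_norm_sq, Finset.mul_sum]
      refine Finset.sum_le_sum fun i _ => ?_
      have h := h_sigMin D s hs (E i)
      have h' : (s * eNorm (E i)) ^ 2 ≤ eNorm (D.vecMul (E i)) ^ 2 :=
        pow_le_pow_left₀ (mul_nonneg hs0.le (Real.sqrt_nonneg _)) h 2
      rw [mul_pow, h_eNorm_sq, h_eNorm_sq] at h'
      exact h'
    have h2 : ‖E * D‖ ^ 2 = (W * (E * D)ᵀ).trace := by
      rw [h_norm_sq_trace, Matrix.transpose_mul, ← Matrix.mul_assoc, ← Matrix.mul_assoc,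
        Matrix.mul_assoc E, hE]
    have h3 : ‖W - E * D‖ ^ 2 = ‖W‖ ^ 2 - 2 * (W * (E * D)ᵀ).trace + ‖E * D‖ ^ 2 := by
      have h4 : (E * D * Wᵀ).trace = (W * (E * D)ᵀ).trace := by
        rw [← Matrix.trace_transpose, Matrix.transpose_mul, Matrix.transpose_transpose]
      rw [h_norm_sq_trace, h_norm_sq_trace W, h_norm_sq_trace (E * D), Matrix.transpose_sub,
        Matrix.mul_sub, Matrix.sub_mul, Matrix.sub_mul]
      simp only [Matrix.trace_sub]
      rw [h4]; ring
    have h5 : ‖W‖ ^ 2 ≤ t * δ ^ 2 := by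
      rw [h_norm_sq, Finset.sum_comm]
      have : ∀ j ∈ (Finset.univ : Finset (Fin t)), ∑ i, W i j ^ 2 ≤ δ ^ 2 := fun j _ => by
        rw [← h_eNorm_sq (fun i => W i j)]
        exact pow_le_pow_left₀ (Real.sqrt_nonneg _) (hW j) 2
      simpa using Finset.sum_le_card_nsmul _ _ _ this
    have h6 : 0 ≤ ‖W - E * D‖ ^ 2 := by positivity
    refine abs_le_of_sq_le_sq' ?_ (by positivity) |>.2
    rw [mul_pow, mul_pow, Real.sq_sqrt (by positivity)]
    linarith

theorem h_core {n m : ℕ} (hn : 0 < n)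
    (A : Matrix (Fin n) (Fin n) ℝ) (B : Matrix (Fin n) (Fin m) ℝ)
    {Q : Matrix (Fin n) (Fin n) ℝ} {R : Matrix (Fin m) (Fin m) ℝ}
    (hQ : Q.PosDef) (hR : R.PosDef)
    (hctrb : (Matrix.of fun (i : Fin n) (p : Fin n × Fin m) =>
        (A ^ (p.1 : ℕ) * B) i p.2).rank = n) :
    ∃ e0 > (0 : ℝ), ∃ c > (0 : ℝ), ∀ (t : ℕ) (D : Matrix (Fin m ⊕ Fin n) (Fin t) ℝ)
      (W : Matrix (Fin n) (Fin t) ℝ) (s δ e : ℝ), 0 < s → 0 ≤ δ → s ≤ sigMin D →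
      (∀ j, eNorm (fun i => W i j) ≤ δ) → IsUnit (D * Dᵀ).det →
      Real.sqrt t * δ ≤ s * e → e ≤ e0 →
      ∃ E : Matrix (Fin n) (Fin m ⊕ Fin n) ℝ, E * (D * Dᵀ) = W * Dᵀ ∧
      (∃ K : Matrix (Fin m) (Fin n) ℝ, specLt1 ((A + E.toCols₂) + (B + E.toCols₁) * K)) ∧
      |hOpt Q R (A + E.toCols₂) (B + E.toCols₁) - hOpt Q R A B| ≤ c * e := by
  obtain ⟨e0, he0, c, hc, hgap⟩ := h_gap hn A B hQ hR hctrb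
  refine ⟨e0, he0, c, hc, ?_⟩
  intro t D W s δ e hs0 hδ hs hW hD hse he
  obtain ⟨E, hE1, hE2⟩ := h_data D W s δ hs0 hδ hs hW hD
  have hEe : ‖E‖ ≤ e := le_of_mul_le_mul_left (hE2.trans hse) hs0
  have hEsq : ‖E‖ ^ 2 = ‖E.toCols₁‖ ^ 2 + ‖E.toCols₂‖ ^ 2 := by
    rw [h_norm_sq, h_norm_sq, h_norm_sq, ← Finset.sum_add_distrib]
    refine Finset.sum_congr rfl fun i _ => ?_
    rw [Fintype.sum_sum_type]
    rfl
  have h2 : ‖E.toCols₂‖ ≤ ‖E‖ :=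
    (abs_le_of_sq_le_sq' (by nlinarith [sq_nonneg ‖E.toCols₁‖]) (norm_nonneg _)).2
  have h1 : ‖E.toCols₁‖ ≤ ‖E‖ :=
    (abs_le_of_sq_le_sq' (by nlinarith [sq_nonneg ‖E.toCols₂‖]) (norm_nonneg _)).2
  obtain ⟨g1, g2⟩ := hgap (A + E.toCols₂) (B + E.toCols₁) e ((norm_nonneg _).trans hEe) he
    (by rw [add_sub_cancel_left]; exact h2.trans hEe)
    (by rw [add_sub_cancel_left]; exact h1.trans hEe)
  exact ⟨E, hE1, g1, g2⟩

end Helpers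

theorem h_Xbar1 {n m t : ℕ} (A : Matrix (Fin n) (Fin n) ℝ) (B : Matrix (Fin n) (Fin m) ℝ)
    (U0 : Matrix (Fin m) (Fin t) ℝ) (X0 X1 W0 : Matrix (Fin n) (Fin t) ℝ)
    (hX : X1 = A * X0 + B * U0 + W0) (E : Matrix (Fin n) (Fin m ⊕ Fin n) ℝ)
    (hE : E * (Dmat U0 X0 * (Dmat U0 X0)ᵀ) = W0 * (Dmat U0 X0)ᵀ) :
    Xbar1 U0 X0 X1 = (A + E.toCols₂) * Xbar0 U0 X0 + (B + E.toCols₁) * Ubar U0 X0 := by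
  have h1 : W0 * (Dmat U0 X0)ᵀ = E.toCols₁ * (U0 * (Dmat U0 X0)ᵀ) +
      E.toCols₂ * (X0 * (Dmat U0 X0)ᵀ) := by
    rw [← hE, ← Matrix.mul_assoc, ← Matrix.mul_assoc, ← Matrix.mul_assoc, ← Matrix.add_mul]
    congr 1
    rw [← Matrix.fromCols_mul_fromRows, Matrix.fromCols_toCols]
    rfl
  unfold Xbar1 Xbar0 Ubar
  rw [hX]
  simp only [Matrix.mul_smul, ← smul_add]
  congr 1
  simp only [Matrix.add_mul]
  rw [h1]
  simp only [Matrix.mul_assoc]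
  abel

theorem h_images {n m t : ℕ} (ht : 0 < t) (A : Matrix (Fin n) (Fin n) ℝ)
    (B : Matrix (Fin n) (Fin m) ℝ)
    (Q : Matrix (Fin n) (Fin n) ℝ) (R : Matrix (Fin m) (Fin m) ℝ)
    (U0 : Matrix (Fin m) (Fin t) ℝ) (X0 X1 : Matrix (Fin n) (Fin t) ℝ)
    (hD : IsUnit (Dmat U0 X0 * (Dmat U0 X0)ᵀ).det)
    (hX : Xbar1 U0 X0 X1 = A * Xbar0 U0 X0 + B * Ubar U0 X0) :
    Jcost U0 X0 X1 Q R '' feasSet U0 X0 X1 = hCost Q R A B '' {K | specLt1 (A + B * K)} := by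
  have key : ∀ V : Matrix (Fin m ⊕ Fin n) (Fin n) ℝ, Xbar0 U0 X0 * V = 1 →
      Xbar1 U0 X0 X1 * V = A + B * (Ubar U0 X0 * V) := by
    intro V hV
    rw [hX, Matrix.add_mul, Matrix.mul_assoc, Matrix.mul_assoc, hV, Matrix.mul_one]
  have key2 : ∀ V : Matrix (Fin m ⊕ Fin n) (Fin n) ℝ, Xbar0 U0 X0 * V = 1 →
      Jcost U0 X0 X1 Q R V = hCost Q R A B (Ubar U0 X0 * V) := by
    intro V hV
    unfold Jcost hCost SigV
    rw [key V hV, Matrix.transpose_mul]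
    simp only [Matrix.mul_assoc]
  ext y
  constructor
  · rintro ⟨V, ⟨hV1, hV2⟩, rfl⟩
    refine ⟨Ubar U0 X0 * V, ?_, (key2 V hV1).symm⟩
    rw [key V hV1] at hV2
    exact hV2
  · rintro ⟨K, hK, rfl⟩
    have ht' : (t : ℝ) ≠ 0 := by exact_mod_cast ht.ne'
    set D := Dmat U0 X0 with hDdef
    set V := ((t : ℝ) • (D * Dᵀ)⁻¹) * Matrix.fromRows K (1 : Matrix (Fin n) (Fin n) ℝ) with hV
    have h1 : Matrix.fromRows (Ubar U0 X0 * V) (Xbar0 U0 X0 * V) =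
        Matrix.fromRows K (1 : Matrix (Fin n) (Fin n) ℝ) := by
      rw [← Matrix.fromRows_mul]
      have h2 : Matrix.fromRows (Ubar U0 X0) (Xbar0 U0 X0) = (t : ℝ)⁻¹ • (D * Dᵀ) := by
        have h3 : D * Dᵀ = Matrix.fromRows (U0 * Dᵀ) (X0 * Dᵀ) := by
          rw [← Matrix.fromRows_mul]; rfl
        rw [h3]
        ext (i | i) j <;> rfl
      rw [h2, hV, ← Matrix.mul_assoc, Matrix.mul_smul, Matrix.smul_mul, Matrix.smul_mul,
        Matrix.mul_nonsing_inv _ hD, Matrix.smul_mul, smul_smul, mul_inv_cancel₀ ht', one_smul, Matrix.one_mul]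
    obtain ⟨hU, hX0⟩ := Matrix.fromRows_inj h1
    refine ⟨V, ⟨hX0, ?_⟩, ?_⟩
    · rw [key V hX0, hU]; exact hK
    · rw [key2 V hX0, hU]

/-- Optimal-value gap between the data-driven and the true LQR problems
(Lemma 15). -/
theorem stmt_17 {n m : ℕ} (hn : 0 < n) (hm : 0 < m)
    (A : Matrix (Fin n) (Fin n) ℝ) (B : Matrix (Fin n) (Fin m) ℝ)
    (Q : Matrix (Fin n) (Fin n) ℝ) (R : Matrix (Fin m) (Fin m) ℝ)
    (hQ : Q.PosDef) (hR : R.PosDef)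
    (hctrb : (Matrix.of fun (i : Fin n) (p : Fin n × Fin m) =>
        (A ^ (p.1 : ℕ) * B) i p.2).rank = n) :
    ∃ c₁ > (0 : ℝ), ∃ c₂ > (0 : ℝ),
      ∀ t : ℕ, 0 < t →
      ∀ (U0 : Matrix (Fin m) (Fin t) ℝ) (X0 X1 W0 : Matrix (Fin n) (Fin t) ℝ)
        (γ ζ δ : ℝ), 0 < γ → 0 < ζ → 0 < δ →
        X1 = A * X0 + B * U0 + W0 →
        (Dmat U0 X0).rank = m + n →
        sigMin (Dmat U0 X0) ≥ Real.sqrt t * γ * ζ / 2 →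
        (∀ j, eNorm (fun i => W0 i j) ≤ δ) →
        δ / γ ≤ c₁ * ζ →
        (feasSet U0 X0 X1).Nonempty ∧
        |Jstar U0 X0 X1 Q R -
            sInf ((fun K : Matrix (Fin m) (Fin n) ℝ =>
                Matrix.trace ((Q + Kᵀ * R * K) * lyap (A + B * K))) ''
              {K | specLt1 (A + B * K)})| ≤ c₂ * δ / (γ * ζ) := by
  obtain ⟨e0, he0, c, hc, hcore⟩ := h_core hn A B hQ hR hctrb
  refine ⟨e0 / 2, by positivity, 2 * c, by positivity, ?_⟩
  intro t ht U0 X0 X1 W0 γ ζ δ hγ hζ hδ hX hrank hsig hW hδγ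
  have ht' : (0 : ℝ) < t := by exact_mod_cast ht
  have hst : 0 < Real.sqrt t := Real.sqrt_pos.2 ht'
  have hdet : IsUnit (Dmat U0 X0 * (Dmat U0 X0)ᵀ).det := by
    have hr : (Dmat U0 X0 * (Dmat U0 X0)ᵀ).rank = m + n := by
      rw [Matrix.rank_self_mul_transpose, hrank]
    have hsurj : Function.Surjective (Dmat U0 X0 * (Dmat U0 X0)ᵀ).mulVecLin := by
      rw [← LinearMap.range_eq_top]
      apply Submodule.eq_top_of_finrank_eq
      rw [← Matrix.rank, hr]; simp
    rw [← Matrix.isUnit_iff_isUnit_det]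
    exact Matrix.mulVec_surjective_iff_isUnit.1 hsurj
  obtain ⟨E, hE, ⟨K, hK⟩, hopt⟩ := hcore t (Dmat U0 X0) W0 (Real.sqrt t * γ * ζ / 2) δ
    (2 * δ / (γ * ζ)) (by positivity) hδ.le hsig hW hdet
    (le_of_eq (by field_simp))
    (by
      rw [div_le_iff₀ hγ] at hδγ
      rw [div_le_iff₀ (by positivity)]
      linarith)
  have himg := h_images ht (A + E.toCols₂) (B + E.toCols₁) Q R U0 X0 X1 hdet
    (h_Xbar1 A B U0 X0 X1 W0 hX E hE)
  constructor
  · have hne : (hCost Q R (A + E.toCols₂) (B + E.toCols₁) ''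
        {K | specLt1 ((A + E.toCols₂) + (B + E.toCols₁) * K)}).Nonempty := ⟨_, K, hK, rfl⟩
    rw [← himg] at hne
    exact hne.of_image
  · have h1 : Jstar U0 X0 X1 Q R = hOpt Q R (A + E.toCols₂) (B + E.toCols₁) := by
      unfold Jstar hOpt
      rw [himg]
    rw [h1]
    refine le_trans hopt (le_of_eq ?_)
    ring
end
end
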